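/- arXiv:1201.0936 — 2 statements merged into one kernel-verified Lean document; each statement's English description precedes it below -/
import Mathlib

section
/- For every integer n ≥ 5, the group of ℂ-algebra automorphisms of A = ℂ[x,y,z]/(x^{n−1} + x y² + z²) is isomorphic, as a group, to ℂ* × ℤ/2ℤ. -/
open MvPolynomial

noncomputable section

/-- The ideal (x^(n−1) + x y² + z²) in ℂ[x,y,z]. -/
def Idn (n : ℕ) : Ideal (MvPolynomial (Fin 3) ℂ) :=
  Ideal.span {(X 0 ^ (n - 1) + X 0 * X 1 ^ 2 + X 2 ^ 2 : MvPolynomial (Fin 3) ℂ)}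

/-- The coordinate ring A = ℂ[x,y,z]/(x^(n−1) + x y² + z²) of the Klein surface Dₙ. -/
abbrev Adn (n : ℕ) : Type := MvPolynomial (Fin 3) ℂ ⧸ Idn n

/-! ### The exponential of a derivation -/

theorem Derivation.iterate_apply_mul {R A : Type*} [CommRing R] [CommRing A] [Algebra R A]
    (D : Derivation R A A) (n : ℕ) (a b : A) :
    D^[n] (a * b) =
      ∑ ij ∈ Finset.HasAntidiagonal.antidiagonal n, n.choose ij.1 • (D^[ij.1] a * D^[ij.2] b) := by
  induction n with
  | zero => simp
  | succ n ih =>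
    rw [Finset.sum_antidiagonal_choose_succ_nsmul (fun i j => D^[i] a * D^[j] b) n]
    simp only [Function.iterate_succ_apply', ih, map_sum, map_nsmul, Derivation.leibniz,
      smul_add, Finset.sum_add_distrib, smul_eq_mul]
    congr 1
    refine Finset.sum_congr rfl fun ij hij => ?_
    rw [mul_comm, Nat.choose_symm_of_eq_add (Finset.HasAntidiagonal.mem_antidiagonal.mp hij).symm]

/-- The exponential `a ↦ ∑ Dʲ(a) sʲ / j!` of a derivation, with values in power series. -/
def Derivation.expSeries {A : Type*} [CommRing A] [Algebra ℂ A] (D : Derivation ℂ A A) :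
    A →ₐ[ℂ] PowerSeries A :=
  AlgHom.ofLinearMap
    { toFun := fun a => PowerSeries.mk fun j => ((j.factorial : ℂ)⁻¹) • D^[j] a
      map_add' := fun a b => by
        ext j
        simp [iterate_map_add, smul_add]
      map_smul' := fun c a => by
        ext j
        have h : D^[j] (c • a) = c • D^[j] a := by
          induction j with
          | zero => rfl
          | succ j ih => simp only [Function.iterate_succ_apply', ih, map_smul]
        simp only [PowerSeries.coeff_mk, h, RingHom.id_apply, PowerSeries.coeff_smul]
        rw [smul_comm] }
    (by
      ext j
      rcases j with _ | j
      · simp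
      · have h : D^[j] (0 : A) = 0 := iterate_map_zero D j
        simp [PowerSeries.coeff_one, Function.iterate_succ_apply, h])
    (fun a b => by
      ext j
      simp only [LinearMap.coe_mk, AddHom.coe_mk, PowerSeries.coeff_mk, PowerSeries.coeff_mul,
        Derivation.iterate_apply_mul, Finset.smul_sum]
      refine Finset.sum_congr rfl fun ij hij => ?_
      obtain rfl := Finset.HasAntidiagonal.mem_antidiagonal.mp hij
      rw [← Nat.cast_smul_eq_nsmul ℂ, smul_smul, smul_mul_smul_comm]
      congr 1
      have h := Nat.add_choose_mul_factorial_mul_factorial ij.1 ij.2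
      rw [Nat.choose_symm_add]
      have h1 : ((ij.1 + ij.2).factorial : ℂ) ≠ 0 := by exact_mod_cast Nat.factorial_ne_zero _
      have h2 : (ij.1.factorial : ℂ) ≠ 0 := by exact_mod_cast Nat.factorial_ne_zero _
      have h3 : (ij.2.factorial : ℂ) ≠ 0 := by exact_mod_cast Nat.factorial_ne_zero _
      field_simp
      rw [← h]
      push_cast
      ring)

theorem Derivation.coeff_expSeries {A : Type*} [CommRing A] [Algebra ℂ A] (D : Derivation ℂ A A)
    (a : A) (j : ℕ) : PowerSeries.coeff j (D.expSeries a) = ((j.factorial : ℂ)⁻¹) • D^[j] a := by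
  simp [Derivation.expSeries]

/-! ### Gradings by the natural numbers, as coactions of the multiplicative group -/

/-- An `ℕ`-grading of a `ℂ`-algebra, given by the map sending `a = ∑ aᵢ` to `∑ aᵢ tⁱ`. -/
structure NatCoaction (A : Type*) [CommRing A] [Algebra ℂ A] where
  /-- The map `∑ aᵢ ↦ ∑ aᵢ tⁱ`. -/
  toHom : A →ₐ[ℂ] Polynomial A
  eval_one : ∀ a, (toHom a).eval 1 = a
  toHom_coeff : ∀ a i, toHom ((toHom a).coeff i) = Polynomial.monomial i ((toHom a).coeff i)

namespace NatCoaction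

variable {A : Type*} [CommRing A] [Algebra ℂ A] (G : NatCoaction A)

/-- The homogeneous component of degree `i`. -/
def comp (i : ℕ) : A →ₗ[ℂ] A :=
  ((Polynomial.lcoeff A i).restrictScalars ℂ) ∘ₗ G.toHom.toLinearMap

theorem comp_apply (i : ℕ) (a : A) : G.comp i a = (G.toHom a).coeff i := rfl

/-- Homogeneity of degree `i`. -/
def IsHomog (i : ℕ) (a : A) : Prop := G.toHom a = Polynomial.monomial i a

variable {G}

theorem isHomog_comp (i : ℕ) (a : A) : G.IsHomog i (G.comp i a) := G.toHom_coeff a i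

theorem IsHomog.mul {i j : ℕ} {a b : A} (ha : G.IsHomog i a) (hb : G.IsHomog j b) :
    G.IsHomog (i + j) (a * b) := by
  unfold IsHomog at *
  rw [map_mul, ha, hb, Polynomial.monomial_mul_monomial]

theorem IsHomog.pow {i : ℕ} {a : A} (ha : G.IsHomog i a) (k : ℕ) : G.IsHomog (k * i) (a ^ k) := by
  unfold IsHomog at *
  rw [map_pow, ha, Polynomial.monomial_pow, mul_comm]

theorem IsHomog.comp_eq {i : ℕ} {a : A} (ha : G.IsHomog i a) (j : ℕ) :
    G.comp j a = if i = j then a else 0 := by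
  rw [comp_apply, show G.toHom a = _ from ha, Polynomial.coeff_monomial]

theorem IsHomog.comp_mul {i : ℕ} {a : A} (ha : G.IsHomog i a) (j : ℕ) (b : A) :
    G.comp (i + j) (a * b) = a * G.comp j b := by
  rw [comp_apply, map_mul, show G.toHom a = _ from ha, add_comm, Polynomial.coeff_monomial_mul,
    comp_apply]

theorem sum_comp (a : A) {N : ℕ} (hN : (G.toHom a).natDegree < N) :
    ∑ i ∈ Finset.range N, G.comp i a = a := by
  conv_rhs => rw [← G.eval_one a, Polynomial.eval_eq_sum_range' hN]
  simp [comp_apply]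

theorem homog_induction {P : A → Prop} (h0 : P 0) (hadd : ∀ a b, P a → P b → P (a + b))
    (hh : ∀ i a, G.IsHomog i a → P a) (a : A) : P a := by
  rw [← sum_comp (G := G) a (Nat.lt_succ_self _)]
  exact Finset.sum_induction _ P hadd h0 fun i _ => hh i _ (isHomog_comp i a)

variable (G)

/-- The Euler derivation `∑ aᵢ ↦ ∑ i aᵢ`. -/
def euler : Derivation ℂ A A :=
  Derivation.mk'
    ((((Polynomial.leval (1 : A)) ∘ₗ Polynomial.derivative).restrictScalars ℂ) ∘ₗ
      G.toHom.toLinearMap)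
    (fun a b => by
      simp only [LinearMap.comp_apply, AlgHom.toLinearMap_apply, map_mul,
        LinearMap.restrictScalars_apply, Polynomial.derivative_mul, Polynomial.leval_apply,
        Polynomial.eval_add, Polynomial.eval_mul, G.eval_one, smul_eq_mul]
      ring)

theorem euler_apply (a : A) : G.euler a = (Polynomial.derivative (G.toHom a)).eval 1 := rfl

/-- The component of degree `K` of a derivation. -/
def derivComp (K : ℕ) (δ : Derivation ℂ A A) : A →ₗ[ℂ] A :=
  (Polynomial.lsum fun i => G.comp (i + K) ∘ₗ (δ : A →ₗ[ℂ] A)) ∘ₗ G.toHom.toLinearMap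

variable {G}

theorem IsHomog.euler_eq {i : ℕ} {a : A} (ha : G.IsHomog i a) : G.euler a = (i : ℂ) • a := by
  rw [euler_apply, show G.toHom a = _ from ha, Polynomial.derivative_monomial,
    Polynomial.eval_monomial, one_pow, mul_one, Algebra.smul_def, mul_comm, map_natCast]

theorem IsHomog.derivComp_eq {i : ℕ} {a : A} (ha : G.IsHomog i a) (K : ℕ)
    (δ : Derivation ℂ A A) : G.derivComp K δ a = G.comp (i + K) (δ a) := by
  simp only [derivComp, LinearMap.comp_apply, AlgHom.toLinearMap_apply,
    show G.toHom a = _ from ha, Polynomial.lsum_apply]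
  rw [Polynomial.sum_monomial_index]
  · rfl
  · simp

theorem derivComp_mul (K : ℕ) (δ : Derivation ℂ A A) (a b : A) :
    G.derivComp K δ (a * b) = a * G.derivComp K δ b + b * G.derivComp K δ a := by
  induction a using homog_induction (G := G) with
  | h0 => simp
  | hadd a a' ha ha' => simp only [add_mul, map_add, ha, ha', mul_add]; ring
  | hh i a ha =>
    induction b using homog_induction (G := G) with
    | h0 => simp
    | hadd b b' hb hb' => simp only [add_mul, map_add, hb, hb', mul_add]; ring
    | hh j b hb =>
      rw [(ha.mul hb).derivComp_eq, ha.derivComp_eq, hb.derivComp_eq, Derivation.leibniz, map_add,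
        smul_eq_mul, smul_eq_mul, add_assoc i j K, ha.comp_mul, ← add_assoc, add_comm i j,
        add_assoc j i K, hb.comp_mul]

variable (G)

/-- The component of degree `K` of a derivation, as a derivation. -/
def derivCompDer (K : ℕ) (δ : Derivation ℂ A A) : Derivation ℂ A A :=
  Derivation.mk' (G.derivComp K δ) fun a b => by
    simpa only [smul_eq_mul] using derivComp_mul K δ a b

variable {G}

theorem IsHomog.derivCompDer_eq {i : ℕ} {a : A} (ha : G.IsHomog i a) (K : ℕ)
    (δ : Derivation ℂ A A) : G.derivCompDer K δ a = G.comp (i + K) (δ a) :=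
  ha.derivComp_eq K δ

theorem comp_eq_zero_of_natDegree_lt {a : A} {i : ℕ} (h : (G.toHom a).natDegree < i) :
    G.comp i a = 0 := Polynomial.coeff_eq_zero_of_natDegree_lt h

/-- If `δ` raises degrees by at most `K`, then its component of degree `K` computes leading
terms. -/
theorem comp_apply_of_natDegree_le {K : ℕ} {δ : Derivation ℂ A A}
    (hδ : ∀ i a, G.IsHomog i a → (G.toHom (δ a)).natDegree ≤ i + K)
    {a : A} {i : ℕ} (ha : (G.toHom a).natDegree ≤ i) :
    (G.toHom (δ a)).natDegree ≤ i + K ∧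
      G.comp (i + K) (δ a) = G.derivCompDer K δ (G.comp i a) := by
  have key := sum_comp (G := G) a (Nat.lt_succ_of_le ha)
  constructor
  · rw [← key, map_sum, map_sum]
    refine Polynomial.natDegree_sum_le_of_forall_le _ _ fun j hj => ?_
    have := hδ j _ (isHomog_comp (G := G) j a)
    have := Finset.mem_range.mp hj
    omega
  · rw [(isHomog_comp i a).derivCompDer_eq]
    conv_lhs => rw [← key, Finset.sum_range_succ, map_add, map_add, map_sum, map_sum]
    rw [Finset.sum_eq_zero, zero_add]
    intro j hj
    refine comp_eq_zero_of_natDegree_lt ?_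
    have := hδ j _ (isHomog_comp (G := G) j a)
    have := Finset.mem_range.mp hj
    omega

theorem IsHomog.natDegree_le {i : ℕ} {a : A} (ha : G.IsHomog i a) :
    (G.toHom a).natDegree ≤ i := by
  rw [show G.toHom a = _ from ha]
  exact Polynomial.natDegree_monomial_le _

theorem comp_iterate {K : ℕ} {δ : Derivation ℂ A A}
    (hδ : ∀ i a, G.IsHomog i a → (G.toHom (δ a)).natDegree ≤ i + K)
    {a : A} {i : ℕ} (ha : G.IsHomog i a) (j : ℕ) :
    (G.toHom (δ^[j] a)).natDegree ≤ i + j * K ∧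
      G.comp (i + j * K) (δ^[j] a) = (G.derivCompDer K δ)^[j] a := by
  induction j with
  | zero => simpa using ⟨ha.natDegree_le, by simp [ha.comp_eq]⟩
  | succ j ih =>
    simp only [Function.iterate_succ_apply']
    rw [show i + (j + 1) * K = i + j * K + K by ring, ← ih.2]
    exact comp_apply_of_natDegree_le hδ ih.1

theorem isHomog_iterate_derivCompDer {K : ℕ} {δ : Derivation ℂ A A} {a : A} {i : ℕ}
    (ha : G.IsHomog i a) (j : ℕ) : G.IsHomog (i + j * K) ((G.derivCompDer K δ)^[j] a) := by
  induction j with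
  | zero => simpa using ha
  | succ j ih =>
    simp only [Function.iterate_succ_apply']
    rw [ih.derivCompDer_eq, show i + (j + 1) * K = i + j * K + K by ring]
    exact isHomog_comp _ _

variable (G)

/-- The conjugate of the Euler derivation by an automorphism. -/
def conjEuler (φ : A ≃ₐ[ℂ] A) : Derivation ℂ A A :=
  Derivation.mk' (φ.toLinearMap ∘ₗ (G.euler : A →ₗ[ℂ] A) ∘ₗ φ.symm.toLinearMap) fun a b => by
    simp [Derivation.leibniz]

variable {G}

theorem conjEuler_apply (φ : A ≃ₐ[ℂ] A) (a : A) :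
    G.conjEuler φ (φ a) = φ (G.euler a) := by
  change φ (G.euler (φ.symm (φ a))) = _
  rw [φ.symm_apply_apply]

theorem exists_natDegree_iterate_conjEuler_le (φ : A ≃ₐ[ℂ] A) (a : A) :
    ∃ M, ∀ j, (G.toHom ((G.conjEuler φ)^[j] a)).natDegree ≤ M := by
  obtain ⟨b, rfl⟩ := φ.surjective a
  induction b using homog_induction (G := G) with
  | h0 => exact ⟨0, fun j => by simp [iterate_map_zero]⟩
  | hadd a b ha hb =>
    obtain ⟨M, hM⟩ := ha
    obtain ⟨N, hN⟩ := hb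
    refine ⟨max M N, fun j => ?_⟩
    rw [map_add, iterate_map_add, map_add]
    exact (Polynomial.natDegree_add_le _ _).trans (max_le_max (hM j) (hN j))
  | hh i a ha =>
    refine ⟨(G.toHom (φ a)).natDegree, fun j => ?_⟩
    have h : (G.conjEuler φ)^[j] (φ a) = ((i : ℂ) ^ j) • φ a := by
      induction j with
      | zero => simp
      | succ j ih =>
        rw [Function.iterate_succ_apply', ih, Derivation.map_smul, conjEuler_apply, ha.euler_eq,
          map_smul, smul_smul, pow_succ]
    rw [h, map_smul]
    exact Polynomial.natDegree_smul_le _ _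

theorem exists_iterate_derivCompDer_eq_zero (φ : A ≃ₐ[ℂ] A) {K : ℕ} (hK : 0 < K)
    (hδ : ∀ i a, G.IsHomog i a → (G.toHom (G.conjEuler φ a)).natDegree ≤ i + K)
    {a : A} {i : ℕ} (ha : G.IsHomog i a) :
    ∃ j, (G.derivCompDer K (G.conjEuler φ))^[j] a = 0 := by
  obtain ⟨M, hM⟩ := exists_natDegree_iterate_conjEuler_le (G := G) φ a
  refine ⟨M + 1, ?_⟩
  rw [← (comp_iterate hδ ha _).2]
  refine comp_eq_zero_of_natDegree_lt ((hM _).trans_lt ?_)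
  nlinarith

theorem comp_euler (i : ℕ) (a : A) : G.comp i (G.euler a) = (i : ℂ) • G.comp i a := by
  induction a using homog_induction (G := G) with
  | h0 => simp
  | hadd a b ha hb => simp only [map_add, ha, hb, smul_add]
  | hh j a ha =>
    rw [ha.euler_eq, map_smul, ha.comp_eq]
    split_ifs with h
    · rw [h]
    · simp

/-- The eigenvectors of the Euler derivation are the homogeneous elements. -/
theorem exists_isHomog_of_euler_eq {a : A} (ha : a ≠ 0) {μ : ℂ} (h : G.euler a = μ • a) :
    ∃ i : ℕ, μ = i ∧ G.IsHomog i a := by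
  have hcomp : ∀ i : ℕ, G.comp i a ≠ 0 → μ = i := by
    intro i hi
    have h1 := comp_euler (G := G) i a
    rw [h, map_smul, ← sub_eq_zero, ← sub_smul] at h1
    exact sub_eq_zero.mp ((smul_eq_zero.mp h1).resolve_right hi)
  have hsum := sum_comp (G := G) a (Nat.lt_succ_self _)
  obtain ⟨i, hi, hne⟩ := Finset.exists_ne_zero_of_sum_ne_zero (hsum.symm ▸ ha)
  refine ⟨i, hcomp i hne, ?_⟩
  rw [Finset.sum_eq_single_of_mem i hi] at hsum
  · rw [← hsum]
    exact isHomog_comp i a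
  · intro j _ hji
    by_contra hj
    exact hji (Nat.cast_injective (R := ℂ) ((hcomp j hj).symm.trans (hcomp i hne)))

end NatCoaction

/-! ### Polynomial curves on the surface -/

namespace Polynomial

theorem exists_eq_pow_of_isCoprime_of_mul_eq_pow {a b c : Polynomial ℂ} (hab : IsCoprime a b)
    {k : ℕ} (hk : 0 < k) (h : a * b = c ^ k) : ∃ d, a = d ^ k := by
  obtain ⟨d, u, hu⟩ := exists_associated_pow_of_mul_eq_pow' hab h
  obtain ⟨e, -, he⟩ := Polynomial.isUnit_iff.mp u.isUnit
  obtain ⟨g, hg⟩ := IsAlgClosed.exists_pow_nat_eq e hk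
  refine ⟨d * C g, ?_⟩
  rw [mul_pow, ← C_pow, hg, he, hu]

theorem isCoprime_of_no_common_root {a b : Polynomial ℂ}
    (h : ∀ s, a.eval s = 0 → b.eval s ≠ 0) : IsCoprime a b := by
  rw [Polynomial.isCoprime_iff_aeval_ne_zero_of_isAlgClosed ℂ ℂ]
  intro s
  rw [← not_and_or]
  rintro ⟨h1, h2⟩
  exact h s (by simpa using h1) (by simpa using h2)

theorem eq_C_of_no_root {a : Polynomial ℂ} (h : ∀ s, a.eval s ≠ 0) : ∃ c, a = C c := by
  by_cases hd : a.degree = 0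
  · exact ⟨_, eq_C_of_degree_eq_zero hd⟩
  · obtain ⟨s, hs⟩ := IsAlgClosed.exists_root a hd
    exact absurd hs (h s)

/-- A polynomial curve on the Klein surface that avoids the origin lifts to the plane. -/
theorem exists_lift_of_klein_curve {m : ℕ} (hm : 0 < m) {x y z : Polynomial ℂ}
    (h : x ^ (m + 1) + x * y ^ 2 + z ^ 2 = 0) (hxy : ∀ s, x.eval s = 0 → y.eval s ≠ 0) :
    ∃ r w : Polynomial ℂ, x = (r * w) ^ 2 ∧ y = C (1 / 2) * (w ^ (2 * m) - r ^ (2 * m)) ∧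
      z = C (Complex.I / 2) * (r * w) * (w ^ (2 * m) + r ^ (2 * m)) := by
  have hI : (C Complex.I : Polynomial ℂ) ^ 2 = -1 := by
    rw [← C_pow, Complex.I_sq]; simp
  have hhalf : (C (1 / 2) : Polynomial ℂ) * 2 = 1 := by
    rw [show (2 : Polynomial ℂ) = C 2 from rfl, ← C_mul]; norm_num
  have hcop : IsCoprime x (x ^ m + y ^ 2) := by
    refine isCoprime_of_no_common_root fun s hs => ?_
    simpa [hs, hm.ne'] using hxy s hs
  have hprod : x * (x ^ m + y ^ 2) = (C Complex.I * z) ^ 2 := by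
    rw [mul_pow, hI]; linear_combination h
  obtain ⟨p, hp⟩ := exists_eq_pow_of_isCoprime_of_mul_eq_pow hcop two_pos hprod
  obtain ⟨q, hq⟩ := exists_eq_pow_of_isCoprime_of_mul_eq_pow hcop.symm two_pos
    ((mul_comm _ _).trans hprod)
  obtain ⟨q, hq, hz⟩ : ∃ q, x ^ m + y ^ 2 = q ^ 2 ∧ z = C Complex.I * (p * q) := by
    have h1 : z ^ 2 = (C Complex.I * (p * q)) ^ 2 := by
      rw [mul_pow, hI, mul_pow, ← hp, ← hq]; linear_combination h
    rcases sq_eq_sq_iff_eq_or_eq_neg.mp h1 with h2 | h2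
    · exact ⟨q, hq, h2⟩
    · exact ⟨-q, by rw [hq]; ring, by rw [h2]; ring⟩
  have hfac : (q - y) * (q + y) = p ^ (2 * m) := by
    rw [pow_mul, ← hp]; linear_combination -hq
  have hcop' : IsCoprime (q - y) (q + y) := by
    refine isCoprime_of_no_common_root fun s hs hs' => ?_
    have hy : y.eval s = 0 := by
      rw [eval_sub] at hs
      rw [eval_add] at hs'
      linear_combination (hs' - hs) / 2
    refine hxy s ?_ hy
    have h1 := congrArg (eval s) hfac
    rw [eval_mul, hs, zero_mul, eval_pow] at h1
    have h2 : p.eval s = 0 := by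
      by_contra hne
      exact pow_ne_zero _ hne h1.symm
    rw [hp, eval_pow, h2]
    simp
  have h2m : 0 < 2 * m := by omega
  obtain ⟨r, hr⟩ := exists_eq_pow_of_isCoprime_of_mul_eq_pow hcop' h2m hfac
  obtain ⟨w, hw⟩ := exists_eq_pow_of_isCoprime_of_mul_eq_pow hcop'.symm h2m
    ((mul_comm _ _).trans hfac)
  obtain ⟨r, hr, hpr⟩ : ∃ r, q - y = r ^ (2 * m) ∧ p = r * w := by
    have h1 : (r * w) ^ (2 * m) = p ^ (2 * m) := by rw [mul_pow, ← hr, ← hw, hfac]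
    obtain ⟨u, hu⟩ : Associated (r * w) p := by
      rw [← dvd_dvd_iff_associated]
      exact ⟨(IsIntegrallyClosed.pow_dvd_pow_iff h2m.ne').mp h1.dvd,
        (IsIntegrallyClosed.pow_dvd_pow_iff h2m.ne').mp h1.symm.dvd⟩
    obtain ⟨e, he0, he⟩ := Polynomial.isUnit_iff.mp u.isUnit
    rw [← he] at hu
    by_cases hzero : r * w = 0
    · exact ⟨r, hr, by rw [← hu, hzero, zero_mul]⟩
    · refine ⟨r * C e, ?_, by rw [← hu]; ring⟩
      have h3 : (r * w) ^ (2 * m) * (C e ^ (2 * m) - 1) = 0 := by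
        rw [mul_sub, ← mul_pow, hu, h1]; ring
      rcases mul_eq_zero.mp h3 with h4 | h4
      · exact absurd h4 (pow_ne_zero _ hzero)
      · rw [mul_pow, sub_eq_zero.mp h4, mul_one, hr]
  refine ⟨r, w, by rw [hp, hpr], ?_, ?_⟩
  · rw [← hr, ← hw]; linear_combination -y * hhalf
  · have hI2 : (C (Complex.I / 2) : Polynomial ℂ) = C Complex.I * C (1 / 2) := by
      rw [← C_mul]; ring_nf
    rw [← hr, ← hw, hz, hpr, hI2]
    linear_combination -C Complex.I * (r * w * q) * hhalf

end Polynomial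

/-! ### The coordinate ring of the Klein surface -/

namespace Adn

variable (m : ℕ)

/-- The three coordinate functions. -/
def gen (i : Fin 3) : Adn (m + 2) := Ideal.Quotient.mk (Idn (m + 2)) (X i)

theorem rel : gen m 0 ^ (m + 1) + gen m 0 * gen m 1 ^ 2 + gen m 2 ^ 2 = 0 := by
  simp only [gen, ← map_pow, ← map_mul, ← map_add]
  exact Ideal.Quotient.eq_zero_iff_mem.mpr (Ideal.subset_span rfl)

variable {m}

/-- The homomorphism defined by a solution of the equation of the surface. -/
def lift {B : Type*} [CommRing B] [Algebra ℂ B] (b : Fin 3 → B)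
    (h : b 0 ^ (m + 1) + b 0 * b 1 ^ 2 + b 2 ^ 2 = 0) : Adn (m + 2) →ₐ[ℂ] B :=
  Ideal.Quotient.liftₐ (Idn (m + 2)) (aeval b) (by
    intro a ha
    obtain ⟨c, rfl⟩ := Ideal.mem_span_singleton'.mp ha
    have : m + 2 - 1 = m + 1 := rfl
    simp [this, h])

@[simp]
theorem lift_gen {B : Type*} [CommRing B] [Algebra ℂ B] (b : Fin 3 → B)
    (h : b 0 ^ (m + 1) + b 0 * b 1 ^ 2 + b 2 ^ 2 = 0) (i : Fin 3) : lift b h (gen m i) = b i := by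
  change aeval b (X i) = b i
  simp

theorem algHom_ext {B : Type*} [CommRing B] [Algebra ℂ B] {f g : Adn (m + 2) →ₐ[ℂ] B}
    (h : ∀ i, f (gen m i) = g (gen m i)) : f = g := by
  apply Ideal.Quotient.algHom_ext
  apply MvPolynomial.algHom_ext
  exact h

theorem monomial_induction {P : Adn (m + 2) → Prop} (hadd : ∀ a b, P a → P b → P (a + b))
    (hmon : ∀ (c : ℂ) (p q r : ℕ), P (c • (gen m 0 ^ p * gen m 1 ^ q * gen m 2 ^ r)))
    (a : Adn (m + 2)) : P a := by
  obtain ⟨f, rfl⟩ := Ideal.Quotient.mk_surjective a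
  induction f using MvPolynomial.induction_on' with
  | monomial u c =>
    have h := hmon c (u 0) (u 1) (u 2)
    have e : c • (gen m 0 ^ u 0 * gen m 1 ^ u 1 * gen m 2 ^ u 2) =
        Ideal.Quotient.mk (Idn (m + 2)) (monomial u c) := by
      rw [MvPolynomial.monomial_eq, Finsupp.prod_fintype _ _ (by simp), Fin.prod_univ_three]
      simp only [gen, ← map_pow, ← map_mul, ← MvPolynomial.smul_eq_C_mul]
      rfl
    rwa [← e]
  | add p q hp hq => rw [map_add]; exact hadd _ _ hp hq

variable (m)

/-- The weights of the coordinate functions. -/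
def wt : Fin 3 → ℕ := ![2, m, m + 1]

/-- The map `∑ aᵢ ↦ ∑ aᵢ tⁱ` of the weighted grading. -/
def coactionHom : Adn (m + 2) →ₐ[ℂ] Polynomial (Adn (m + 2)) :=
  lift (fun i => Polynomial.monomial (wt m i) (gen m i)) (by
    simp only [wt, Polynomial.monomial_pow, Polynomial.monomial_mul_monomial, Matrix.cons_val]
    rw [show 2 + m * 2 = 2 * (m + 1) by ring,
      show (m + 1) * 2 = 2 * (m + 1) by ring, ← map_add, ← map_add, rel, map_zero])

variable {m}

theorem coactionHom_gen (i : Fin 3) :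
    coactionHom m (gen m i) = Polynomial.monomial (wt m i) (gen m i) := by
  simp [coactionHom]

theorem coactionHom_monomial (p q r : ℕ) :
    coactionHom m (gen m 0 ^ p * gen m 1 ^ q * gen m 2 ^ r) =
      Polynomial.monomial (2 * p + m * q + (m + 1) * r)
        (gen m 0 ^ p * gen m 1 ^ q * gen m 2 ^ r) := by
  simp only [map_mul, map_pow, coactionHom_gen, Polynomial.monomial_pow,
    Polynomial.monomial_mul_monomial]
  rfl

variable (m)

/-- The weighted grading of the coordinate ring. -/
def grading : NatCoaction (Adn (m + 2)) where
  toHom := coactionHom m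
  eval_one := fun a => by
    have h : ((Polynomial.aeval (1 : Adn (m + 2))).restrictScalars ℂ).comp (coactionHom m) =
        AlgHom.id ℂ (Adn (m + 2)) := algHom_ext fun i => by
      simp [coactionHom_gen]
    simpa [Polynomial.aeval_def] using DFunLike.congr_fun h a
  toHom_coeff := fun a j => by
    induction a using monomial_induction with
    | hadd a b ha hb => simp only [map_add, Polynomial.coeff_add, ha, hb]
    | hmon c p q r =>
      rw [map_smul, coactionHom_monomial, Polynomial.coeff_smul, Polynomial.coeff_monomial]
      split_ifs with h
      · rw [map_smul, coactionHom_monomial, h, Polynomial.smul_monomial]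
      · simp

variable {m}

theorem isHomog_gen (i : Fin 3) : (grading m).IsHomog (wt m i) (gen m i) := coactionHom_gen i

theorem isHomog_monomial (p q r : ℕ) : (grading m).IsHomog (2 * p + m * q + (m + 1) * r)
    (gen m 0 ^ p * gen m 1 ^ q * gen m 2 ^ r) := coactionHom_monomial p q r

theorem comp_mem_span (a : Adn (m + 2)) (i : ℕ) : (grading m).comp i a ∈ Submodule.span ℂ
    {b | ∃ p q r, 2 * p + m * q + (m + 1) * r = i ∧
      b = gen m 0 ^ p * gen m 1 ^ q * gen m 2 ^ r} := by
  induction a using monomial_induction with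
  | hadd a b ha hb => rw [map_add]; exact add_mem ha hb
  | hmon c p q r =>
    rw [map_smul, (isHomog_monomial p q r).comp_eq]
    refine Submodule.smul_mem _ _ ?_
    split_ifs with h
    · exact Submodule.subset_span ⟨p, q, r, h, rfl⟩
    · exact zero_mem _

theorem IsHomog.mem_span {a : Adn (m + 2)} {i : ℕ} (ha : (grading m).IsHomog i a) :
    a ∈ Submodule.span ℂ {b | ∃ p q r, 2 * p + m * q + (m + 1) * r = i ∧
      b = gen m 0 ^ p * gen m 1 ^ q * gen m 2 ^ r} := by
  have h := comp_mem_span a i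
  rwa [ha.comp_eq, if_pos rfl] at h

/-- Elements of low degree. -/
theorem exists_of_natDegree_le (hm : 3 ≤ m) {a : Adn (m + 2)} {d : ℕ} (hd : d ≤ m + 1)
    (ha : ((grading m).toHom a).natDegree ≤ d) :
    ∃ (p : Polynomial ℂ) (β γ : ℂ), 2 * p.natDegree ≤ d ∧ (d < m → β = 0) ∧ (d < m + 1 → γ = 0) ∧
      a = Polynomial.aeval (gen m 0) p + β • gen m 1 + γ • gen m 2 := by
  rw [← NatCoaction.sum_comp (G := grading m) a (Nat.lt_succ_of_le ha)]
  refine Finset.sum_induction _ (fun a => ∃ (p : Polynomial ℂ) (β γ : ℂ), 2 * p.natDegree ≤ d ∧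
    (d < m → β = 0) ∧ (d < m + 1 → γ = 0) ∧
      a = Polynomial.aeval (gen m 0) p + β • gen m 1 + γ • gen m 2) ?_ ?_ ?_
  · rintro _ _ ⟨p, β, γ, h1, h2, h3, rfl⟩ ⟨p', β', γ', h1', h2', h3', rfl⟩
    refine ⟨p + p', β + β', γ + γ', ?_, fun h => by rw [h2 h, h2' h, add_zero],
      fun h => by rw [h3 h, h3' h, add_zero], ?_⟩
    · have := Polynomial.natDegree_add_le p p'
      omega
    · simp only [map_add, add_smul]; ring
  · exact ⟨0, 0, 0, by simp⟩
  · intro i hi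
    have hid : i ≤ d := Nat.lt_succ_iff.mp (Finset.mem_range.mp hi)
    refine Submodule.span_induction ?_ ⟨0, 0, 0, by simp⟩ ?_ ?_ (comp_mem_span a i)
    · rintro _ ⟨p, q, r, hw, rfl⟩
      have hqr : q + r ≤ 1 := by
        by_contra hlt
        have : m * 2 ≤ m * (q + r) := Nat.mul_le_mul_left _ (by omega)
        nlinarith
      rcases q with _ | q
      · rcases r with _ | r
        · refine ⟨Polynomial.X ^ p, 0, 0, ?_, by simp, by simp, by simp⟩
          rw [Polynomial.natDegree_X_pow]
          simp only [mul_zero, add_zero] at hw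
          omega
        · obtain rfl : r = 0 := by omega
          simp only [zero_add, mul_zero, add_zero, mul_one] at hw
          obtain rfl : p = 0 := by omega
          exact ⟨0, 0, 1, by simp, by simp, by omega, by simp⟩
      · obtain rfl : q = 0 := by omega
        obtain rfl : r = 0 := by omega
        simp only [zero_add, mul_zero, add_zero, mul_one] at hw
        obtain rfl : p = 0 := by omega
        exact ⟨0, 1, 0, by simp, by omega, by simp, by simp⟩
    · rintro _ _ _ _ ⟨p, β, γ, h1, h2, h3, rfl⟩ ⟨p', β', γ', h1', h2', h3', rfl⟩
      refine ⟨p + p', β + β', γ + γ', ?_, fun h => by rw [h2 h, h2' h, add_zero],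
        fun h => by rw [h3 h, h3' h, add_zero], ?_⟩
      · have := Polynomial.natDegree_add_le p p'
        omega
      · simp only [map_add, add_smul]; ring
    · rintro c _ _ ⟨p, β, γ, h1, h2, h3, rfl⟩
      refine ⟨c • p, c * β, c * γ, ?_, fun h => by rw [h2 h, mul_zero],
        fun h => by rw [h3 h, mul_zero], ?_⟩
      · have := Polynomial.natDegree_smul_le c p
        omega
      · simp only [map_smul, smul_add, smul_smul]

/-! ### Separation by points -/

theorem exists_rep (a : Adn (m + 2)) : ∃ p q : MvPolynomial (Fin 2) ℂ,
    a = aeval ![gen m 0, gen m 1] p + gen m 2 * aeval ![gen m 0, gen m 1] q := by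
  induction a using monomial_induction with
  | hadd a b ha hb =>
    obtain ⟨p, q, rfl⟩ := ha
    obtain ⟨p', q', rfl⟩ := hb
    exact ⟨p + p', q + q', by simp only [map_add]; ring⟩
  | hmon c i j r =>
    induction r with
    | zero => exact ⟨c • (X 0 ^ i * X 1 ^ j), 0, by simp⟩
    | succ r ih =>
      obtain ⟨p, q, h⟩ := ih
      refine ⟨-(X 0 ^ (m + 1) + X 0 * X 1 ^ 2) * q, p, ?_⟩
      rw [pow_succ, ← mul_assoc, ← smul_mul_assoc, h]
      simp only [map_mul, map_neg, map_add, map_pow, aeval_X, Matrix.cons_val]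
      linear_combination (aeval ![gen m 0, gen m 1] q) * rel m

theorem eval_eq_zero_of_rep {p q : MvPolynomial (Fin 2) ℂ}
    (h : ∀ f : Adn (m + 2) →ₐ[ℂ] ℂ,
      f (aeval ![gen m 0, gen m 1] p + gen m 2 * aeval ![gen m 0, gen m 1] q) = 0) :
    p = 0 ∧ q = 0 := by
  have key : ∀ (v : Fin 2 → ℂ) (c : ℂ), c ^ 2 = -(v 0 ^ (m + 1) + v 0 * v 1 ^ 2) →
      eval v p + c * eval v q = 0 := by
    intro v c hc
    have h1 := h (lift ![v 0, v 1, c] (by simp [hc]))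
    have h2 : ∀ a : MvPolynomial (Fin 2) ℂ, lift ![v 0, v 1, c] (by simp [hc])
        (aeval ![gen m 0, gen m 1] a) = eval v a := by
      intro a
      have : (lift (m := m) ![v 0, v 1, c] (by simp [hc])).comp (aeval ![gen m 0, gen m 1]) =
          aeval v := by
        apply MvPolynomial.algHom_ext
        intro i
        fin_cases i <;> simp
      simpa using DFunLike.congr_fun this a
    rw [map_add, map_mul, h2, h2, lift_gen] at h1
    exact h1
  have key2 : ∀ v : Fin 2 → ℂ, eval v p = 0 ∧ (v 0 ^ (m + 1) + v 0 * v 1 ^ 2) * eval v q = 0 := by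
    intro v
    obtain ⟨c, hc⟩ := IsAlgClosed.exists_pow_nat_eq (-(v 0 ^ (m + 1) + v 0 * v 1 ^ 2)) two_pos
    have h1 := key v c hc
    have h2 := key v (-c) (by rw [neg_sq, hc])
    constructor
    · linear_combination (h1 + h2) / 2
    · linear_combination (eval v q) * hc - c * (h1 - h2) / 2
  constructor
  · exact MvPolynomial.funext fun v => by simpa using (key2 v).1
  · have h3 : (X 0 ^ (m + 1) + X 0 * X 1 ^ 2 : MvPolynomial (Fin 2) ℂ) * q = 0 :=
      MvPolynomial.funext fun v => by simpa using (key2 v).2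
    rcases mul_eq_zero.mp h3 with h4 | h4
    · have := congrArg (eval ![1, 1]) h4
      norm_num at this
    · exact h4

theorem exists_point_ne_zero {a : Adn (m + 2)} (ha : a ≠ 0) :
    ∃ f : Adn (m + 2) →ₐ[ℂ] ℂ, f a ≠ 0 := by
  by_contra! hcon
  obtain ⟨p, q, rfl⟩ := exists_rep a
  obtain ⟨rfl, rfl⟩ := eval_eq_zero_of_rep hcon
  simp at ha

theorem rep_unique {p q : MvPolynomial (Fin 2) ℂ}
    (h : aeval ![gen m 0, gen m 1] p + gen m 2 * aeval ![gen m 0, gen m 1] q = 0) :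
    p = 0 ∧ q = 0 :=
  eval_eq_zero_of_rep fun f => by rw [h, map_zero]

/-! ### The quotient map from the plane -/

/-- The homomorphism of a point of the plane, the surface being a quotient of the plane. -/
def planeHom (m : ℕ) {B : Type*} [CommRing B] [Algebra ℂ B] (α β : B) : Adn (m + 2) →ₐ[ℂ] B :=
  lift ![(α * β) ^ 2, algebraMap ℂ B (1 / 2) * (β ^ (2 * m) - α ^ (2 * m)),
    algebraMap ℂ B (Complex.I / 2) * (α * β) * (β ^ (2 * m) + α ^ (2 * m))] (by
    have hI : algebraMap ℂ B (Complex.I / 2) ^ 2 = - algebraMap ℂ B (1 / 2) ^ 2 := by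
      rw [← map_pow, ← map_pow, ← map_neg]
      congr 1
      rw [div_pow, Complex.I_sq]
      ring
    have h4 : 4 * algebraMap ℂ B (1 / 2) ^ 2 = 1 := by
      rw [← map_pow, show (4 : B) = algebraMap ℂ B 4 from (map_ofNat _ 4).symm, ← map_mul,
        ← map_one (algebraMap ℂ B)]
      congr 1
      norm_num
    simp only [Matrix.cons_val]
    have e1 : ((α * β) ^ 2) ^ (m + 1) = (α * β) ^ 2 * (α ^ (2 * m) * β ^ (2 * m)) := by
      rw [← mul_pow]; ring
    rw [e1]
    linear_combination (α * β) ^ 2 * (β ^ (2 * m) + α ^ (2 * m)) ^ 2 * hI -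
      (α * β) ^ 2 * (α ^ (2 * m) * β ^ (2 * m)) * h4)

theorem map_planeHom {B B' : Type*} [CommRing B] [Algebra ℂ B] [CommRing B'] [Algebra ℂ B']
    (g : B →ₐ[ℂ] B') (α β : B) (f : Adn (m + 2)) :
    g (planeHom m α β f) = planeHom m (g α) (g β) f := by
  have : g.comp (planeHom m α β) = planeHom m (g α) (g β) := by
    refine algHom_ext fun i => ?_
    fin_cases i <;> simp [planeHom]
  exact DFunLike.congr_fun this f

theorem planeHom_mul {f : Adn (m + 2)} {d : ℕ} (hf : (grading m).IsHomog d f) (κ α β : ℂ) :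
    planeHom m (κ * α) (κ * β) f = (κ ^ 2) ^ d * planeHom m α β f := by
  have : planeHom m (κ * α) (κ * β) = (Polynomial.aeval (κ ^ 2)).comp
      ((Polynomial.mapAlgHom (planeHom m α β)).comp (grading m).toHom) := by
    refine algHom_ext fun i => ?_
    rw [AlgHom.comp_apply, AlgHom.comp_apply,
      show (grading m).toHom (gen m i) = _ from isHomog_gen i]
    fin_cases i <;> simp [planeHom, wt, Polynomial.aeval_monomial, mul_pow, pow_succ, pow_mul] <;>
      ring
  rw [this, AlgHom.comp_apply, AlgHom.comp_apply, show (grading m).toHom f = _ from hf]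
  simp [Polynomial.aeval_monomial, mul_comm]

theorem planeHom_zero {f : Adn (m + 2)} {d : ℕ} (hd : d ≠ 0) (hf : (grading m).IsHomog d f) :
    planeHom m (0 : ℂ) 0 f = 0 := by
  have := planeHom_mul hf 0 0 0
  simpa [hd] using this

/-- A homogeneous function of positive degree vanishes somewhere outside the origin. -/
theorem exists_planeHom_eq_zero {f : Adn (m + 2)} {d : ℕ} (hd : d ≠ 0)
    (hf : (grading m).IsHomog d f) :
    ∃ α β : ℂ, (α ≠ 0 ∨ β ≠ 0) ∧ planeHom m α β f = 0 := by
  by_contra! hcon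
  have hev : ∀ t (p q : Polynomial ℂ), (planeHom m p q f).eval t =
      planeHom m (p.eval t) (q.eval t) f := fun t p q => by
    simpa [Polynomial.aeval_def] using
      map_planeHom ((Polynomial.aeval t : Polynomial ℂ →ₐ[ℂ] ℂ)) p q f
  obtain ⟨c, hc⟩ := Polynomial.eq_C_of_no_root (a := planeHom m Polynomial.X 1 f) fun t => by
    rw [hev]
    exact hcon _ _ (Or.inr (by simp))
  have hpol : Polynomial.X *
      (planeHom m 1 Polynomial.X f - Polynomial.C c * Polynomial.X ^ (2 * d)) = 0 := by
    refine Polynomial.funext fun t => ?_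
    simp only [Polynomial.eval_mul, Polynomial.eval_X, Polynomial.eval_sub, hev,
      Polynomial.eval_one, Polynomial.eval_C, Polynomial.eval_pow, Polynomial.eval_zero]
    by_cases ht : t = 0
    · simp [ht]
    have h1 := planeHom_mul hf t t⁻¹ 1
    have h2 := hev t⁻¹ Polynomial.X 1
    rw [hc, Polynomial.eval_C, Polynomial.eval_X, Polynomial.eval_one] at h2
    rw [mul_inv_cancel₀ ht, mul_one, ← h2] at h1
    rw [h1, pow_mul]
    ring
  have h0 := (mul_eq_zero.mp hpol).resolve_left Polynomial.X_ne_zero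
  have h1 := congrArg (Polynomial.eval 0) h0
  simp only [Polynomial.eval_sub, hev, Polynomial.eval_mul, Polynomial.eval_pow, Polynomial.eval_X,
    Polynomial.eval_one, Polynomial.eval_C, Polynomial.eval_zero] at h1
  rw [zero_pow (by omega), mul_zero, sub_zero] at h1
  exact hcon 1 0 (Or.inl one_ne_zero) h1

/-- Two independent zeros of a function on the plane that is pulled back from the surface. -/
theorem exists_planeHom_eq_zero_independent (hm : 2 ≤ m) {f : Adn (m + 2)} {α β : ℂ}
    (h0 : α ≠ 0 ∨ β ≠ 0) (h : planeHom m α β f = 0) :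
    ∃ α' β' : ℂ, (α' ≠ 0 ∨ β' ≠ 0) ∧ planeHom m α' β' f = 0 ∧ α * β' - β * α' ≠ 0 := by
  have h2m : 0 < 2 * m := by omega
  have transfer : ∀ α' β' : ℂ, α' * β' = α * β →
      β' ^ (2 * m) - α' ^ (2 * m) = β ^ (2 * m) - α ^ (2 * m) →
      α * β * (β' ^ (2 * m) + α' ^ (2 * m)) = α * β * (β ^ (2 * m) + α ^ (2 * m)) →
      planeHom m α' β' f = 0 := by
    intro α' β' h1 h2 h3
    rw [← h]
    congr 1
    refine algHom_ext fun i => ?_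
    fin_cases i
    · simp [planeHom, h1]
    · simp [planeHom, h2]
    · simp [planeHom, h1, mul_assoc, h3]
  obtain ⟨ω, hω⟩ := IsAlgClosed.exists_pow_nat_eq (-1 : ℂ) h2m
  have hω0 : ω ≠ 0 := by
    rintro rfl
    rw [zero_pow h2m.ne'] at hω
    norm_num at hω
  by_cases hα : α = 0
  · subst hα
    have hβ : β ≠ 0 := by simpa using h0
    refine ⟨ω * β, 0, Or.inl (mul_ne_zero hω0 hβ), transfer _ _ ?_ ?_ ?_, ?_⟩
    · simp
    · rw [mul_pow, hω, zero_pow h2m.ne']; ring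
    · simp
    · simp [hβ, hω0]
  by_cases hβ : β = 0
  · subst hβ
    refine ⟨0, ω * α, Or.inr (mul_ne_zero hω0 hα), transfer _ _ ?_ ?_ ?_, ?_⟩
    · simp
    · rw [mul_pow, hω, zero_pow h2m.ne']; ring
    · simp
    · simp [hα, hω0]
  obtain ⟨ζ, hζ⟩ : ∃ ζ : ℂ, IsPrimitiveRoot ζ (2 * m) := ⟨_, Complex.isPrimitiveRoot_exp _ h2m.ne'⟩
  have hζ0 : ζ ≠ 0 := hζ.ne_zero h2m.ne'
  refine ⟨ζ * α, ζ⁻¹ * β, Or.inl (mul_ne_zero hζ0 hα), transfer _ _ ?_ ?_ ?_, ?_⟩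
  · field_simp
  · rw [mul_pow, mul_pow, inv_pow, hζ.pow_eq_one]; simp
  · rw [mul_pow, mul_pow, inv_pow, hζ.pow_eq_one]; simp
  · intro hz
    have h1 : α * β * (1 - ζ ^ 2) = 0 := by
      field_simp at hz
      linear_combination hz
    have h2 : ζ ^ 2 = 1 := by
      have := (mul_eq_zero.mp h1).resolve_left (mul_ne_zero hα hβ)
      linear_combination -this
    have h3 := hζ.dvd_of_pow_eq_one 2 h2
    have := Nat.le_of_dvd two_pos h3
    omega

/-! ### Rigidity -/

/-- The surface contains no polynomial curve on which a homogeneous function of positive degree is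
a nonzero constant. -/
theorem eq_C_of_homog_eq_C (hm : 2 ≤ m) (ψ : Adn (m + 2) →ₐ[ℂ] Polynomial ℂ) {f : Adn (m + 2)}
    {d : ℕ} (hd : d ≠ 0) (hf : (grading m).IsHomog d f) {c : ℂ} (hc : c ≠ 0)
    (hψ : ψ f = Polynomial.C c) (a : Adn (m + 2)) : ∃ e, ψ a = Polynomial.C e := by
  have hrel : ψ (gen m 0) ^ (m + 1) + ψ (gen m 0) * ψ (gen m 1) ^ 2 + ψ (gen m 2) ^ 2 = 0 := by
    simp only [← map_pow, ← map_mul, ← map_add, rel, map_zero]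
  obtain ⟨r, w, hx, hy, hz⟩ := Polynomial.exists_lift_of_klein_curve (by omega) hrel (by
    intro s h0 h1
    have h2 : (ψ (gen m 2)).eval s = 0 := by
      have := congrArg (Polynomial.eval s) hrel
      simpa [h0, h1] using this
    have h3 : (Polynomial.aeval s).comp ψ = planeHom m (0 : ℂ) 0 := by
      refine algHom_ext fun i => ?_
      fin_cases i
      · simpa [planeHom, Polynomial.aeval_def] using h0
      · simpa [planeHom, Polynomial.aeval_def] using h1
      · simpa [planeHom, Polynomial.aeval_def] using h2
    have h4 := DFunLike.congr_fun h3 f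
    rw [planeHom_zero hd hf, AlgHom.comp_apply, hψ] at h4
    exact hc (by simpa using h4))
  have hψ' : ψ = planeHom m r w := by
    refine algHom_ext fun i => ?_
    fin_cases i
    · simpa [planeHom] using hx
    · simpa [planeHom, Polynomial.algebraMap_eq] using hy
    · simpa [planeHom, Polynomial.algebraMap_eq] using hz
  have hval : ∀ s, planeHom m (r.eval s) (w.eval s) f = c := by
    intro s
    have h1 := map_planeHom (Polynomial.aeval s : Polynomial ℂ →ₐ[ℂ] ℂ) r w f
    rw [← hψ', hψ] at h1
    simpa [Polynomial.aeval_def] using h1.symm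
  have hconst : ∀ α β : ℂ, (α ≠ 0 ∨ β ≠ 0) → planeHom m α β f = 0 →
      ∃ e, Polynomial.C β * r - Polynomial.C α * w = Polynomial.C e := by
    intro α β h0 h
    refine Polynomial.eq_C_of_no_root fun s hs => ?_
    simp only [Polynomial.eval_sub, Polynomial.eval_mul, Polynomial.eval_C] at hs
    obtain ⟨κ, h1, h2⟩ : ∃ κ, r.eval s = κ * α ∧ w.eval s = κ * β := by
      rcases h0 with h0 | h0
      · refine ⟨r.eval s / α, by field_simp, ?_⟩
        field_simp
        linear_combination -hs
      · refine ⟨w.eval s / β, ?_, by field_simp⟩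
        field_simp
        linear_combination hs
    have h3 := hval s
    rw [h1, h2, planeHom_mul hf, h, mul_zero] at h3
    exact hc h3.symm
  obtain ⟨α, β, h0, h⟩ := exists_planeHom_eq_zero hd hf
  obtain ⟨α', β', h0', h', hdet⟩ := exists_planeHom_eq_zero_independent hm h0 h
  obtain ⟨e, he⟩ := hconst α β h0 h
  obtain ⟨e', he'⟩ := hconst α' β' h0' h'
  have hinv : Polynomial.C (α * β' - β * α')⁻¹ *
      (Polynomial.C α * Polynomial.C β' - Polynomial.C β * Polynomial.C α') = 1 := by
    rw [← Polynomial.C_mul, ← Polynomial.C_mul, ← Polynomial.C_sub, ← Polynomial.C_mul,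
      inv_mul_cancel₀ hdet, Polynomial.C_1]
  have hr : r = algebraMap ℂ (Polynomial ℂ) ((α * β' - β * α')⁻¹ * (α * e' - α' * e)) := by
    simp only [Polynomial.algebraMap_eq, Polynomial.C_mul, Polynomial.C_sub, ← he, ← he']
    linear_combination -r * hinv
  have hw : w = algebraMap ℂ (Polynomial ℂ) ((α * β' - β * α')⁻¹ * (β * e' - β' * e)) := by
    simp only [Polynomial.algebraMap_eq, Polynomial.C_mul, Polynomial.C_sub, ← he, ← he']
    linear_combination -w * hinv
  refine ⟨planeHom m ((α * β' - β * α')⁻¹ * (α * e' - α' * e))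
    ((α * β' - β * α')⁻¹ * (β * e' - β' * e)) a, ?_⟩
  rw [hψ', hr, hw]
  exact (map_planeHom (Algebra.ofId ℂ (Polynomial ℂ)) _ _ a).symm

/-- There is no nonzero homogeneous locally nilpotent derivation of nonnegative degree. -/
theorem derivation_gen_eq_zero (hm : 2 ≤ m) (D : Derivation ℂ (Adn (m + 2)) (Adn (m + 2))) (K : ℕ)
    (hhom : ∀ i j, (grading m).IsHomog (wt m i + j * K) (D^[j] (gen m i)))
    (hnil : ∀ i, ∃ j, D^[j] (gen m i) = 0) (i : Fin 3) : D (gen m i) = 0 := by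
  classical
  by_contra hDi
  obtain ⟨N, hN1, hN, hN'⟩ : ∃ N, 1 ≤ N ∧ D^[N] (gen m i) ≠ 0 ∧ D (D^[N] (gen m i)) = 0 := by
    have hfind := Nat.find_spec (hnil i)
    have hmin := fun j => Nat.find_min (hnil i) (m := j)
    have h2 : 2 ≤ Nat.find (hnil i) := by
      by_contra hlt
      have h3 : Nat.find (hnil i) ≤ 1 := by omega
      have h4 : D^[1] (gen m i) = 0 := by
        obtain ⟨k, hk⟩ := Nat.exists_eq_add_of_le' h3
        rw [hk, Function.iterate_add_apply, hfind, iterate_map_zero]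
      exact hDi h4
    obtain ⟨k, hk⟩ := Nat.exists_eq_add_of_le' h2
    refine ⟨k + 1, by omega, hmin _ (by omega), ?_⟩
    rw [← Function.iterate_succ_apply' D, Nat.succ_eq_add_one, ← hk]
    exact hfind
  set f := D^[N] (gen m i) with hfdef
  obtain ⟨ι, hι⟩ := exists_point_ne_zero hN
  choose M hM using hnil
  have hM' : ∀ k j, M k ≤ j → D^[j] (gen m k) = 0 := by
    intro k j hj
    obtain ⟨l, rfl⟩ := Nat.exists_eq_add_of_le' hj
    rw [Function.iterate_add_apply, hM, iterate_map_zero]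
  let Ψ : Adn (m + 2) →ₐ[ℂ] PowerSeries ℂ := (PowerSeries.mapAlgHom ι).comp D.expSeries
  have hΨ : ∀ a j, PowerSeries.coeff j (Ψ a) = (j.factorial : ℂ)⁻¹ * ι (D^[j] a) := by
    intro a j
    change ι (PowerSeries.coeff j (D.expSeries a)) = _
    rw [Derivation.coeff_expSeries, map_smul, smul_eq_mul]
  let P : Fin 3 → Polynomial ℂ := fun k => PowerSeries.trunc (M k) (Ψ (gen m k))
  have hP : ∀ k, (P k : PowerSeries ℂ) = Ψ (gen m k) := by
    intro k
    ext j
    rw [Polynomial.coeff_coe, PowerSeries.coeff_trunc]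
    split_ifs with h
    · rfl
    · rw [hΨ, hM' k j (by omega), map_zero, mul_zero]
  have hPrel : P 0 ^ (m + 1) + P 0 * P 1 ^ 2 + P 2 ^ 2 = 0 := by
    apply Polynomial.coe_injective ℂ
    simp only [Polynomial.coe_add, Polynomial.coe_mul, Polynomial.coe_pow, hP, Polynomial.coe_zero,
      ← map_pow, ← map_mul, ← map_add, rel, map_zero]
  have hcoe : ∀ a, ((lift P hPrel a : Polynomial ℂ) : PowerSeries ℂ) = Ψ a := by
    intro a
    have : (Polynomial.coeToPowerSeries.algHom ℂ).comp (lift P hPrel) = Ψ := by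
      refine algHom_ext fun k => ?_
      rw [AlgHom.comp_apply, lift_gen, Polynomial.coeToPowerSeries.algHom_apply, ← hP]
      simp
    rw [← this, AlgHom.comp_apply, Polynomial.coeToPowerSeries.algHom_apply]
    simp
  have hf : lift P hPrel f = Polynomial.C (ι f) := by
    apply Polynomial.coe_injective ℂ
    ext j
    rw [hcoe, hΨ, Polynomial.coe_C, PowerSeries.coeff_C]
    rcases j with _ | j
    · simp
    · rw [Function.iterate_succ_apply, hN', iterate_map_zero]
      simp
  have hwt : wt m i ≠ 0 := by
    fin_cases i
    · simp [wt]
    · simp only [wt]; simp; omega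
    · simp [wt]
  obtain ⟨e, he⟩ := eq_C_of_homog_eq_C hm (lift P hPrel) (by omega : wt m i + N * K ≠ 0)
    (hhom i N) hι hf (gen m i)
  have h1 := hΨ (gen m i) N
  rw [← hcoe, he, Polynomial.coe_C, PowerSeries.coeff_C, if_neg (by omega)] at h1
  exact mul_ne_zero (inv_ne_zero (by exact_mod_cast Nat.factorial_ne_zero N)) hι h1.symm

theorem natDegree_derivation_le (δ : Derivation ℂ (Adn (m + 2)) (Adn (m + 2))) (K : ℕ)
    (hK : ∀ i, ((grading m).toHom (δ (gen m i))).natDegree ≤ wt m i + K) (d : ℕ)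
    (a : Adn (m + 2)) (ha : (grading m).IsHomog d a) :
    ((grading m).toHom (δ a)).natDegree ≤ d + K := by
  have hmul : ∀ (i j : ℕ) (a b : Adn (m + 2)), (grading m).IsHomog i a → (grading m).IsHomog j b →
      ((grading m).toHom (δ a)).natDegree ≤ i + K → ((grading m).toHom (δ b)).natDegree ≤ j + K →
      ((grading m).toHom (δ (a * b))).natDegree ≤ i + j + K := by
    intro i j a b ha hb ha' hb'
    rw [Derivation.leibniz, map_add, smul_eq_mul, smul_eq_mul, map_mul, map_mul]
    refine (Polynomial.natDegree_add_le _ _).trans (max_le ?_ ?_)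
    · refine Polynomial.natDegree_mul_le.trans ?_
      have := ha.natDegree_le
      omega
    · refine Polynomial.natDegree_mul_le.trans ?_
      have := hb.natDegree_le
      omega
  have hpow : ∀ (i : Fin 3) (k : ℕ),
      ((grading m).toHom (δ (gen m i ^ k))).natDegree ≤ k * wt m i + K := by
    intro i k
    induction k with
    | zero => simp
    | succ k ih =>
      have := hmul _ _ _ _ ((isHomog_gen i).pow k) (isHomog_gen i) ih (hK i)
      rwa [← pow_succ, ← Nat.succ_mul] at this
  refine Submodule.span_induction ?_ (by simp) ?_ ?_ (IsHomog.mem_span ha)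
  · rintro _ ⟨p, q, r, rfl, rfl⟩
    have h1 := hmul _ _ _ _ ((isHomog_gen 0).pow p) ((isHomog_gen 1).pow q) (hpow 0 p) (hpow 1 q)
    have h2 := hmul _ _ _ _ (((isHomog_gen 0).pow p).mul ((isHomog_gen 1).pow q))
      ((isHomog_gen 2).pow r) h1 (hpow 2 r)
    refine h2.trans (le_of_eq ?_)
    simp only [wt, Matrix.cons_val]
    ring
  · intro a b _ _ ha hb
    rw [map_add, map_add]
    exact (Polynomial.natDegree_add_le _ _).trans (max_le ha hb)
  · intro c a _ ha
    rw [Derivation.map_smul, map_smul]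
    exact (Polynomial.natDegree_smul_le _ _).trans ha

theorem natDegree_conjEuler_gen_le (hm : 2 ≤ m) (φ : Adn (m + 2) ≃ₐ[ℂ] Adn (m + 2)) (i : Fin 3) :
    ((grading m).toHom ((grading m).conjEuler φ (gen m i))).natDegree ≤ wt m i := by
  set δ := (grading m).conjEuler φ
  obtain ⟨i₀, -, hmax⟩ := Finset.exists_max_image Finset.univ
    (fun i => ((grading m).toHom (δ (gen m i))).natDegree - wt m i) ⟨i, Finset.mem_univ i⟩
  set K := ((grading m).toHom (δ (gen m i₀))).natDegree - wt m i₀ with hK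
  have hle : ∀ j, ((grading m).toHom (δ (gen m j))).natDegree ≤ wt m j + K := fun j => by
    have := hmax j (Finset.mem_univ j)
    omega
  rcases Nat.eq_zero_or_pos K with h0 | hpos
  · simpa [h0] using hle i
  exfalso
  have hδ := natDegree_derivation_le δ K hle
  have hz := derivation_gen_eq_zero hm ((grading m).derivCompDer K δ) K
    (fun i j => NatCoaction.isHomog_iterate_derivCompDer (isHomog_gen i) j)
    (fun i => NatCoaction.exists_iterate_derivCompDer_eq_zero φ hpos hδ (isHomog_gen i)) i₀
  rw [(isHomog_gen i₀).derivCompDer_eq, NatCoaction.comp_apply,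
    show wt m i₀ + K = ((grading m).toHom (δ (gen m i₀))).natDegree by omega] at hz
  have h1 := Polynomial.leadingCoeff_eq_zero.mp hz
  rw [h1, Polynomial.natDegree_zero] at hK
  omega

/-! ### Automorphisms are diagonal -/

theorem smul_def (c : ℂ) (a : Adn (m + 2)) : c • a = algebraMap ℂ (Adn (m + 2)) c * a :=
  Algebra.smul_def c a

theorem gen_ne_zero (i : Fin 3) : gen m i ≠ 0 := by
  intro h
  fin_cases i
  · have h1 := (rep_unique (m := m) (p := X 0) (q := 0) (by simpa using h)).1
    exact X_ne_zero _ h1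
  · have h1 := (rep_unique (m := m) (p := X 1) (q := 0) (by simpa using h)).1
    exact X_ne_zero _ h1
  · have h1 := (rep_unique (m := m) (p := 0) (q := 1) (by simpa using h)).2
    exact one_ne_zero h1

theorem aeval_aeval_X (P : Polynomial ℂ) :
    aeval ![gen m 0, gen m 1] (Polynomial.aeval (X 0 : MvPolynomial (Fin 2) ℂ) P) =
      Polynomial.aeval (gen m 0) P := by
  rw [← Polynomial.aeval_algHom_apply]
  simp

theorem eval_aeval_X (P : Polynomial ℂ) (v : Fin 2 → ℂ) :
    eval v (Polynomial.aeval (X 0 : MvPolynomial (Fin 2) ℂ) P) = P.eval (v 0) := by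
  have := Polynomial.aeval_algHom_apply (aeval v : MvPolynomial (Fin 2) ℂ →ₐ[ℂ] ℂ) (X 0) P
  simpa [Polynomial.aeval_def, MvPolynomial.aeval_def] using this.symm

/-- Elements whose degrees do not exceed those of the coordinate functions. -/
theorem exists_normal_form (hm : 3 ≤ m) (g : Fin 3 → Adn (m + 2))
    (hg : ∀ i, ((grading m).toHom (g i)).natDegree ≤ wt m i) :
    ∃ (α β γ δ ε : ℂ) (P Q : Polynomial ℂ),
      g 0 = α • gen m 0 + β • 1 ∧ g 1 = γ • gen m 1 + Polynomial.aeval (gen m 0) P ∧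
        g 2 = δ • gen m 2 + ε • gen m 1 + Polynomial.aeval (gen m 0) Q := by
  have h0 := hg 0
  have h1 := hg 1
  have h2 := hg 2
  simp only [wt, Matrix.cons_val] at h0 h1 h2
  obtain ⟨p, b, c, hp, hb, hc, e0⟩ := exists_of_natDegree_le hm (by omega) h0
  obtain ⟨P, γ, c', -, -, hc', e1⟩ := exists_of_natDegree_le hm (by omega) h1
  obtain ⟨Q, ε, δ, -, -, -, e2⟩ := exists_of_natDegree_le hm le_rfl h2
  refine ⟨p.coeff 1, p.coeff 0, γ, δ, ε, P, Q, ?_, ?_, ?_⟩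
  · rw [e0, hb (by omega), hc (by omega)]
    conv_lhs => rw [Polynomial.eq_X_add_C_of_natDegree_le_one (p := p) (by omega)]
    simp [smul_def]
  · rw [e1, hc' (by omega), zero_smul, add_zero]
    ring
  · rw [e2]
    ring

theorem poly_eq_zero_of_forall {P : Polynomial ℂ} (h : ∀ s, s * P.eval s = 0) : P = 0 := by
  have : Polynomial.X * P = 0 := Polynomial.funext fun s => by simpa using h s
  exact (mul_eq_zero.mp this).resolve_left Polynomial.X_ne_zero

/-- A derivation that does not raise degrees is a multiple of the Euler derivation. -/
theorem exists_derivation_gen_eq (hm : 3 ≤ m) (D : Derivation ℂ (Adn (m + 2)) (Adn (m + 2)))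
    (hD : ∀ i, ((grading m).toHom (D (gen m i))).natDegree ≤ wt m i) :
    ∃ c : ℂ, ∀ i, D (gen m i) = (c * wt m i) • gen m i := by
  obtain ⟨α, β, γ, δ, ε, P, Q, h0, h1, h2⟩ := exists_normal_form hm (fun i => D (gen m i)) hD
  have hrel := congrArg D (rel m)
  simp only [map_add, Derivation.leibniz, Derivation.leibniz_pow, map_zero, smul_eq_mul,
    nsmul_eq_mul, h0, h1, h2, Nat.add_sub_cancel] at hrel
  have hrep := rep_unique (m := m)
    (p := ((m : ℂ) + 1) • (X 0 ^ m * (α • X 0 + β • 1)) + X 1 ^ 2 * (α • X 0 + β • 1) +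
      (2 : ℂ) • (X 0 * X 1 * (γ • X 1 + Polynomial.aeval (X 0) P)) -
      (2 * δ) • (X 0 ^ (m + 1) + X 0 * X 1 ^ 2))
    (q := (2 : ℂ) • (ε • X 1 + Polynomial.aeval (X 0) Q)) (by
      simp only [map_add, map_sub, map_mul, map_smul, map_pow, aeval_X, aeval_aeval_X,
        Matrix.cons_val, map_one, smul_def, map_natCast, map_ofNat]
      simp only [smul_def] at hrel
      push_cast at hrel
      linear_combination hrel - 2 * algebraMap ℂ (Adn (m + 2)) δ * rel m)
  have hp := fun s t : ℂ => congrArg (eval ![s, t]) hrep.1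
  have hq := fun s t : ℂ => congrArg (eval ![s, t]) hrep.2
  simp only [map_add, map_sub, map_mul, smul_eval, map_pow, eval_X, eval_aeval_X, Matrix.cons_val,
    map_one, map_zero] at hp hq
  have hQ : Q = 0 := poly_eq_zero_of_forall fun s => by linear_combination s / 2 * hq s 0
  subst hQ
  have hε : ε = 0 := by
    have := hq 0 1
    simp only [Polynomial.eval_zero] at this
    linear_combination this / 2
  have hβ : β = 0 := by
    have := hp 0 1
    rw [zero_pow (by omega), zero_pow (by omega)] at this
    linear_combination this
  have hP : P = 0 := poly_eq_zero_of_forall fun s => by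
    linear_combination (hp s 1 - hp s (-1)) / 4
  subst hP hβ hε
  have e1 := hp 1 0
  have e2 := hp 1 1
  simp only [one_pow, Polynomial.eval_zero] at e1 e2
  refine ⟨α / 2, fun i => ?_⟩
  fin_cases i
  · simp only [Fin.zero_eta, h0, wt, Matrix.cons_val, zero_smul, add_zero]
    congr 1
    push_cast
    ring
  · simp only [Fin.mk_one, h1, wt, Matrix.cons_val, map_zero, add_zero]
    congr 1
    linear_combination (e2 - 2 * e1) / 2
  · simp only [Fin.reduceFinMk, h2, wt, Matrix.cons_val, map_zero, add_zero, zero_smul]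
    congr 1
    push_cast
    linear_combination -e1 / 2

theorem derivation_ext {D D' : Derivation ℂ (Adn (m + 2)) (Adn (m + 2))}
    (h : ∀ i, D (gen m i) = D' (gen m i)) : D = D' := by
  ext a
  induction a using monomial_induction with
  | hadd a b ha hb => rw [map_add, map_add, ha, hb]
  | hmon c p q r => simp only [Derivation.map_smul, Derivation.leibniz, Derivation.leibniz_pow, h]

/-- Automorphisms preserve the grading. -/
theorem isHomog_apply_gen (hm : 3 ≤ m) (φ : Adn (m + 2) ≃ₐ[ℂ] Adn (m + 2)) (i : Fin 3) :
    (grading m).IsHomog (wt m i) (φ (gen m i)) := by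
  obtain ⟨c, hc⟩ := exists_derivation_gen_eq hm ((grading m).conjEuler φ)
    (natDegree_conjEuler_gen_le (by omega) φ)
  have hE : (grading m).conjEuler φ = c • (grading m).euler := derivation_ext fun i => by
    rw [hc, Derivation.smul_apply, (isHomog_gen i).euler_eq, smul_smul]
  have hφ : ∀ a, φ ((grading m).euler a) = c • (grading m).euler (φ a) := fun a => by
    rw [← NatCoaction.conjEuler_apply, hE, Derivation.smul_apply]
  have hne : ∀ i, φ (gen m i) ≠ 0 := fun i => by simpa using gen_ne_zero i
  have hne' : ∀ i, φ.symm (gen m i) ≠ 0 := fun i => by simpa using gen_ne_zero i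
  have hwt : ∀ i, (wt m i : ℂ) • φ (gen m i) = c • (grading m).euler (φ (gen m i)) := fun i => by
    rw [← hφ, (isHomog_gen i).euler_eq, map_smul]
  have hc0 : c ≠ 0 := by
    rintro rfl
    have := hwt 0
    rw [zero_smul] at this
    exact (smul_ne_zero (by simp [wt]) (hne 0)) this
  have hev : ∀ i, ∃ k : ℕ, c⁻¹ * wt m i = k ∧ (grading m).IsHomog k (φ (gen m i)) := fun i =>
    NatCoaction.exists_isHomog_of_euler_eq (hne i) (by
      rw [mul_smul, hwt, smul_smul, inv_mul_cancel₀ hc0, one_smul])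
  have hev' : ∀ i, ∃ k : ℕ, c * wt m i = k := fun i => by
    obtain ⟨k, hk, -⟩ := NatCoaction.exists_isHomog_of_euler_eq (G := grading m) (hne' i)
      (μ := c * wt m i) (by
        apply φ.injective
        rw [hφ, φ.apply_symm_apply, (isHomog_gen i).euler_eq, map_smul, φ.apply_symm_apply,
          smul_smul])
    exact ⟨k, hk⟩
  obtain ⟨j₁, hj₁, -⟩ := hev 1
  obtain ⟨k₁, hk₁, -⟩ := hev 2
  obtain ⟨i₂, hi₂⟩ := hev' 0
  obtain ⟨j₂, hj₂⟩ := hev' 1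
  obtain ⟨k₂, hk₂⟩ := hev' 2
  simp only [wt, Matrix.cons_val] at hj₁ hk₁ hi₂ hj₂ hk₂
  push_cast at hj₁ hk₁ hi₂ hj₂ hk₂
  have e1 : c⁻¹ = ((k₁ - j₁ : ℤ) : ℂ) := by push_cast; linear_combination hk₁ - hj₁
  have e2 : c = ((k₂ - j₂ : ℤ) : ℂ) := by push_cast; linear_combination hk₂ - hj₂
  have e3 : (k₂ - j₂ : ℤ) * (k₁ - j₁) = 1 := by
    have := mul_inv_cancel₀ hc0
    rw [e1] at this
    rw [e2] at this
    exact_mod_cast this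
  have e4 : (k₂ - j₂ : ℤ) * 2 = i₂ := by
    apply Int.cast_injective (α := ℂ)
    rw [Int.cast_mul, ← e2]
    exact_mod_cast hi₂
  have e5 : (k₂ - j₂ : ℤ) = 1 := by
    rcases Int.eq_one_or_neg_one_of_mul_eq_one e3 with h | h
    · exact h
    · omega
  rw [e5] at e2
  obtain ⟨k, hk, hk'⟩ := hev i
  rw [e2] at hk
  have : wt m i = k := by
    apply Nat.cast_injective (R := ℂ)
    simpa using hk
  rwa [this]

theorem exists_diagonal (hm : 3 ≤ m) (φ : Adn (m + 2) ≃ₐ[ℂ] Adn (m + 2)) :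
    ∃ α γ δ : ℂ, φ (gen m 0) = α • gen m 0 ∧ φ (gen m 1) = γ • gen m 1 ∧
      φ (gen m 2) = δ • gen m 2 ∧ δ ≠ 0 ∧ α * γ ^ 2 = δ ^ 2 ∧ α ^ (m + 1) = δ ^ 2 := by
  have hhom := isHomog_apply_gen hm φ
  obtain ⟨α, β, γ, δ, ε, P, Q, h0, h1, h2⟩ := exists_normal_form hm (fun i => φ (gen m i))
    fun i => (hhom i).natDegree_le
  have hβ : β = 0 := by
    have h := (hhom 0).euler_eq
    rw [h0, map_add, Derivation.map_smul, Derivation.map_smul, (isHomog_gen 0).euler_eq,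
      Derivation.map_one_eq_zero, smul_zero, add_zero, smul_add, smul_comm, left_eq_add,
      smul_smul] at h
    have h' := (smul_eq_zero.mp h).resolve_right fun h1 =>
      gen_ne_zero (m := m) 0 (by rw [← mul_one (gen m 0), h1, mul_zero])
    simpa [wt] using h'
  subst hβ
  rw [zero_smul, add_zero] at h0
  have hδ : δ ≠ 0 := by
    rintro rfl
    obtain ⟨a, ha⟩ := φ.surjective (gen m 2)
    have hmem : ∀ a, φ a ∈ (aeval (R := ℂ) ![gen m 0, gen m 1]).range := by
      have hx : gen m 0 ∈ (aeval (R := ℂ) ![gen m 0, gen m 1]).range := ⟨X 0, by simp⟩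
      have hy : gen m 1 ∈ (aeval (R := ℂ) ![gen m 0, gen m 1]).range := ⟨X 1, by simp⟩
      have hpoly : ∀ p : Polynomial ℂ, Polynomial.aeval (gen m 0) p ∈
          (aeval (R := ℂ) ![gen m 0, gen m 1]).range := fun p => ⟨_, aeval_aeval_X p⟩
      intro a
      induction a using monomial_induction with
      | hadd a b ha hb => rw [map_add]; exact add_mem ha hb
      | hmon c p q r =>
        rw [map_smul, map_mul, map_mul, map_pow, map_pow, map_pow, h0, h1, h2, zero_smul, zero_add]
        refine Subalgebra.smul_mem _ (mul_mem (mul_mem (pow_mem ?_ _) (pow_mem ?_ _))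
          (pow_mem ?_ _)) _
        · exact Subalgebra.smul_mem _ hx _
        · exact add_mem (Subalgebra.smul_mem _ hy _) (hpoly P)
        · exact add_mem (Subalgebra.smul_mem _ hy _) (hpoly Q)
    obtain ⟨p, hp⟩ := hmem a
    rw [ha] at hp
    have := (rep_unique (m := m) (p := p) (q := -1) (by
      rw [show aeval ![gen m 0, gen m 1] p = _ from hp, map_neg, map_one]; ring)).2
    exact one_ne_zero (neg_eq_zero.mp this)
  have hrel := congrArg φ (rel m)
  simp only [map_add, map_mul, map_pow, map_zero, h0, h1, h2] at hrel
  have hrep := rep_unique (m := m)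
    (p := (α • X 0) ^ (m + 1) + (α • X 0) * (γ • X 1 + Polynomial.aeval (X 0) P) ^ 2 +
      (ε • X 1 + Polynomial.aeval (X 0) Q) ^ 2 - (δ ^ 2) • (X 0 ^ (m + 1) + X 0 * X 1 ^ 2))
    (q := (2 * δ) • (ε • X 1 + Polynomial.aeval (X 0) Q)) (by
      simp only [map_add, map_sub, map_mul, map_smul, map_pow, aeval_X, aeval_aeval_X,
        Matrix.cons_val, smul_def, map_ofNat]
      simp only [smul_def] at hrel
      linear_combination hrel - algebraMap ℂ (Adn (m + 2)) δ ^ 2 * rel m)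
  have hp := fun s t : ℂ => congrArg (eval ![s, t]) hrep.1
  have hq := fun s t : ℂ => congrArg (eval ![s, t]) hrep.2
  simp only [map_add, map_sub, map_mul, smul_eval, map_pow, eval_X, eval_aeval_X, Matrix.cons_val,
    map_zero] at hp hq
  have hq' : ∀ s t, ε * t + Q.eval s = 0 := fun s t =>
    (mul_eq_zero.mp (hq s t)).resolve_left (mul_ne_zero two_ne_zero hδ)
  have hQ : Q = 0 := poly_eq_zero_of_forall fun s => by linear_combination s * hq' s 0
  subst hQ
  have hε : ε = 0 := by simpa using hq' 0 1
  subst hε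
  simp only [Polynomial.eval_zero] at hp
  have hγ : α * γ ^ 2 = δ ^ 2 := by
    linear_combination (hp 1 1 + hp 1 (-1) - 2 * hp 1 0) / 2
  have hαγ : α * γ ≠ 0 := by
    intro h
    apply hδ
    rw [← sq_eq_zero_iff, ← hγ]
    linear_combination γ * h
  have hP : P = 0 := poly_eq_zero_of_forall fun s => by
    apply (mul_eq_zero.mp (?_ : (α * γ) * (s * P.eval s) = 0)).resolve_left hαγ
    linear_combination (hp s 1 - hp s (-1)) / 4
  subst hP
  refine ⟨α, γ, δ, h0, by simpa using h1, by simpa using h2, hδ, hγ, ?_⟩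
  have := hp 1 0
  simp only [Polynomial.eval_zero, mul_one, one_pow] at this
  linear_combination this

/-! ### The group of diagonal automorphisms -/

variable (m) in
/-- The diagonal entries of the automorphism with parameter `t` and sign `e`. -/
def diagCoeff (t : ℂˣ) (e : ℤˣ) : Fin 3 → ℂ :=
  ![(t : ℂ) ^ 2, ((e : ℤ) : ℂ) * (t : ℂ) ^ m, ((e : ℤ) : ℂ) * (t : ℂ) ^ (m + 1)]

theorem diagCoeff_mul (t t' : ℂˣ) (e e' : ℤˣ) (i : Fin 3) :
    diagCoeff m (t * t') (e * e') i = diagCoeff m t e i * diagCoeff m t' e' i := by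
  fin_cases i <;> simp [diagCoeff] <;> ring

theorem sq_intUnit_cast (e : ℤˣ) : ((e : ℤ) : ℂ) ^ 2 = 1 := by
  rcases Int.units_eq_one_or e with rfl | rfl <;> simp

variable (m) in
/-- The diagonal endomorphism with parameter `t` and sign `e`. -/
def diagHom (t : ℂˣ) (e : ℤˣ) : Adn (m + 2) →ₐ[ℂ] Adn (m + 2) :=
  lift (fun i => diagCoeff m t e i • gen m i) (by
    simp only [diagCoeff, Matrix.cons_val, smul_def, map_mul, map_pow]
    have he : algebraMap ℂ (Adn (m + 2)) ((e : ℤ) : ℂ) ^ 2 = 1 := by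
      rw [← map_pow, sq_intUnit_cast, map_one]
    linear_combination (algebraMap ℂ (Adn (m + 2)) t) ^ (2 * (m + 1)) * rel m +
      (algebraMap ℂ (Adn (m + 2)) t) ^ (2 * (m + 1)) *
        (gen m 0 * gen m 1 ^ 2 + gen m 2 ^ 2) * he)

theorem diagHom_gen (t : ℂˣ) (e : ℤˣ) (i : Fin 3) :
    diagHom m t e (gen m i) = diagCoeff m t e i • gen m i := lift_gen _ _ i

theorem diagHom_comp (t t' : ℂˣ) (e e' : ℤˣ) :
    (diagHom m t e).comp (diagHom m t' e') = diagHom m (t * t') (e * e') :=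
  algHom_ext fun i => by
    rw [AlgHom.comp_apply, diagHom_gen, map_smul, diagHom_gen, diagHom_gen, smul_smul,
      diagCoeff_mul, mul_comm]

theorem diagHom_one : diagHom m 1 1 = AlgHom.id ℂ (Adn (m + 2)) :=
  algHom_ext fun i => by
    rw [diagHom_gen]
    fin_cases i <;> simp [diagCoeff]

variable (m) in
/-- The group of diagonal automorphisms. -/
def diagAut : ℂˣ × ℤˣ →* (Adn (m + 2) ≃ₐ[ℂ] Adn (m + 2)) :=
  MonoidHom.mk' (fun u => AlgEquiv.ofAlgHom (diagHom m u.1 u.2) (diagHom m u.1⁻¹ u.2⁻¹)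
    (by rw [diagHom_comp, mul_inv_cancel, mul_inv_cancel, diagHom_one])
    (by rw [diagHom_comp, inv_mul_cancel, inv_mul_cancel, diagHom_one])) fun u v => by
      ext a
      exact (DFunLike.congr_fun (diagHom_comp u.1 v.1 u.2 v.2) a).symm

theorem diagAut_gen (u : ℂˣ × ℤˣ) (i : Fin 3) :
    diagAut m u (gen m i) = diagCoeff m u.1 u.2 i • gen m i := diagHom_gen u.1 u.2 i

theorem diagAut_injective : Function.Injective (diagAut m) := by
  rintro ⟨t, e⟩ ⟨t', e'⟩ h
  have hcoeff : ∀ i, diagCoeff m t e i = diagCoeff m t' e' i := fun i => by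
    have h1 := DFunLike.congr_fun h (gen m i)
    rw [diagAut_gen, diagAut_gen, ← sub_eq_zero, ← sub_smul] at h1
    exact sub_eq_zero.mp ((smul_eq_zero.mp h1).resolve_right (gen_ne_zero i))
  have h1 := hcoeff 1
  have h2 := hcoeff 2
  simp only [diagCoeff, Matrix.cons_val] at h1 h2
  have he' : ((e' : ℤ) : ℂ) ≠ 0 := by exact_mod_cast e'.ne_zero
  have ht : t = t' := by
    ext
    refine mul_left_cancel₀ (mul_ne_zero he' (pow_ne_zero m t'.ne_zero)) ?_
    linear_combination h2 - (t : ℂ) * h1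
  subst ht
  have he := mul_right_cancel₀ (pow_ne_zero m t.ne_zero) h1
  rw [Units.ext (Int.cast_injective he)]

theorem diagAut_surjective (hm : 3 ≤ m) : Function.Surjective (diagAut m) := by
  intro φ
  obtain ⟨α, γ, δ, h0, h1, h2, hδ, h3, h4⟩ := exists_diagonal hm φ
  have hα : α ≠ 0 := by
    rintro rfl
    exact hδ (by simpa using h3.symm)
  have hγ : γ ≠ 0 := by
    rintro rfl
    exact hδ (by simpa using h3.symm)
  let t : ℂˣ := Units.mk0 (δ / γ) (div_ne_zero hδ hγ)
  have ht : (t : ℂ) * γ = δ := div_mul_cancel₀ δ hγ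
  have ht2 : (t : ℂ) ^ 2 = α := by
    refine mul_right_cancel₀ (pow_ne_zero 2 hγ) ?_
    rw [← mul_pow, ht, h3]
  have hγ2 : γ ^ 2 = ((t : ℂ) ^ m) ^ 2 := by
    refine mul_left_cancel₀ hα ?_
    rw [h3, ← h4, ← pow_mul, mul_comm m, pow_mul, ht2, pow_succ, mul_comm]
  obtain ⟨e, he⟩ : ∃ e : ℤˣ, γ = ((e : ℤ) : ℂ) * (t : ℂ) ^ m := by
    rcases sq_eq_sq_iff_eq_or_eq_neg.mp hγ2 with h | h
    · exact ⟨1, by simpa using h⟩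
    · exact ⟨-1, by simpa using h⟩
  refine ⟨(t, e), AlgEquiv.coe_toAlgHom_injective (algHom_ext fun i => ?_)⟩
  change diagAut m (t, e) (gen m i) = φ (gen m i)
  rw [diagAut_gen]
  fin_cases i
  · simp only [Fin.zero_eta, h0, diagCoeff, Matrix.cons_val, ht2]
  · simp only [Fin.mk_one, h1, diagCoeff, Matrix.cons_val, he]
  · simp only [Fin.reduceFinMk, h2, diagCoeff, Matrix.cons_val, ← ht, he]
    congr 1
    ring

end Adn

/-- For n ≥ 5, Aut(A) ≅ ℂ* × ℤ/2ℤ. -/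
theorem dn_aut_group (n : ℕ) (hn : 5 ≤ n) :
    Nonempty ((ℂˣ × Multiplicative (ZMod 2)) ≃* (Adn n ≃ₐ[ℂ] Adn n)) := by
  obtain ⟨m, rfl⟩ := Nat.exists_eq_add_of_le' (show 2 ≤ n by omega)
  let σ : Multiplicative (ZMod 2) ≃* ℤˣ :=
    mulEquivOfPrimeCardEq (p := 2) (by simp) (by simp)
  exact ⟨(MulEquiv.prodCongr (MulEquiv.refl ℂˣ) σ).trans (MulEquiv.ofBijective (Adn.diagAut m)
    ⟨Adn.diagAut_injective, Adn.diagAut_surjective (by omega)⟩)⟩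

end
end

section
/- Let A = ℂ[x,y,z]/(x³ + x y² + z²) and let τ be the ℂ-algebra automorphism of A induced by x ↦ −(1/2)x + (i/2)y, y ↦ (3i/2)x − (1/2)y, z ↦ z. Then every ℂ-algebra automorphism φ of A can be written as φ = g ∘ τᵏ for some k ∈ {0, 1, 2} and some diagonal automorphism g of the form x ↦ λ²x, y ↦ ελ²y, z ↦ ε'λ³z with λ ∈ ℂ* and ε, ε' ∈ {1, −1}. -/
open MvPolynomial

noncomputable section

/-- The ideal (x³ + x y² + z²) in ℂ[x,y,z]. -/
def Id4 : Ideal (MvPolynomial (Fin 3) ℂ) :=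
  Ideal.span {(X 0 ^ 3 + X 0 * X 1 ^ 2 + X 2 ^ 2 : MvPolynomial (Fin 3) ℂ)}

/-- The coordinate ring A = ℂ[x,y,z]/(x³ + x y² + z²) of the Klein surface D₄. -/
abbrev Ad4 : Type := MvPolynomial (Fin 3) ℂ ⧸ Id4

/-- A factor of a perfect square that is relatively prime to its cofactor is a perfect square. -/
theorem exists_eq_sq_of_isRelPrime {σ : Type*} {a b c : MvPolynomial σ ℂ}
    (hab : IsRelPrime a b) (h : a * b = c ^ 2) : ∃ d, a = d ^ 2 := by
  classical
  let := UniqueFactorizationMonoid.toGCDMonoid (MvPolynomial σ ℂ)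
  have hg : IsUnit (gcd a b) := hab (gcd_dvd_left a b) (gcd_dvd_right a b)
  obtain ⟨d, w, hw⟩ := exists_associated_pow_of_mul_eq_pow hg h
  obtain ⟨r, -, hr⟩ := isUnit_iff_eq_C_of_isReduced.mp w.isUnit
  obtain ⟨s, hs⟩ := IsAlgClosed.exists_pow_nat_eq r (n := 2) (by norm_num)
  refine ⟨d * C s, ?_⟩
  rw [← hw, hr, ← hs, C_pow]
  ring

theorem totalDegree_pderiv_le {σ : Type*} (i : σ) (p : MvPolynomial σ ℂ) :
    (pderiv i p).totalDegree ≤ p.totalDegree - 1 := by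
  classical
  refine Finset.sup_le fun m hm => ?_
  have h : m + Finsupp.single i 1 ∈ p.support := by
    rw [mem_support_iff, coeff_pderiv] at *
    exact left_ne_zero_of_mul hm
  have := le_totalDegree h
  rw [Finsupp.sum_add_index' (by simp) (by simp)] at this
  simp at this
  omega

theorem eq_C_of_dvd_pderiv {σ : Type*} {p : MvPolynomial σ ℂ}
    (h : ∀ i, p ∣ pderiv i p) : p = C (coeff 0 p) := by
  classical
  rcases eq_or_ne p 0 with rfl | hp
  · simp
  have hz : ∀ i, pderiv i p = 0 := by
    intro i
    by_contra hne
    obtain ⟨q, hq⟩ := h i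
    have hq0 : q ≠ 0 := by
      rintro rfl
      exact hne (by simpa using hq)
    have hle := totalDegree_pderiv_le i p
    have hdeg := congrArg totalDegree hq
    rw [totalDegree_mul_of_isDomain hp hq0] at hdeg
    have h0 : p.totalDegree = 0 := by omega
    rw [totalDegree_eq_zero_iff_eq_C] at h0
    rw [h0] at hne
    simp at hne
  ext m
  rw [coeff_C]
  split_ifs with hm
  · rw [hm]
  · obtain ⟨i, hi⟩ : ∃ i, m i ≠ 0 := by
      by_contra hc
      push Not at hc
      exact hm (Finsupp.ext fun i => (hc i).symm)
    have hc := congrArg (coeff (m - Finsupp.single i 1)) (hz i)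
    have hle : Finsupp.single i 1 ≤ m := by
      simpa [Nat.one_le_iff_ne_zero] using hi
    rw [coeff_pderiv, tsub_add_cancel_of_le hle, coeff_zero] at hc
    refine (mul_eq_zero.mp hc).resolve_right ?_
    exact Nat.cast_add_one_ne_zero _

/-- The Jacobian determinant of a pair of polynomials in two variables. -/
def jac (p q : MvPolynomial (Fin 2) ℂ) : MvPolynomial (Fin 2) ℂ :=
  pderiv 0 p * pderiv 1 q - pderiv 1 p * pderiv 0 q

theorem exists_common_factor_of_jac_eq_zero {m : ℕ} (hm : m ≠ 0)
    {F G : MvPolynomial (Fin 2) ℂ} (hF : F.IsHomogeneous m) (hG : G.IsHomogeneous m)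
    (h : jac F G = 0) :
    ∃ (T : MvPolynomial (Fin 2) ℂ) (a b : ℂ), F = C a * T ∧ G = C b * T := by
  rcases eq_or_ne F 0 with rfl | hF0
  · exact ⟨G, 0, 1, by simp, by simp⟩
  have eF := hF.sum_X_mul_pderiv
  have eG := hG.sum_X_mul_pderiv
  simp only [Fin.sum_univ_two, nsmul_eq_mul] at eF eG
  unfold jac at h
  have hm' : (m : MvPolynomial (Fin 2) ℂ) ≠ 0 := by exact_mod_cast hm
  have key : ∀ i, G * pderiv i F = F * pderiv i G := by
    intro i
    refine mul_left_cancel₀ hm' ?_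
    fin_cases i
    · simp only [Fin.zero_eta]
      linear_combination (-pderiv 0 F) * eG + (pderiv 0 G) * eF + X 1 * h
    · simp only [Fin.mk_one]
      linear_combination (-pderiv 1 F) * eG + (pderiv 1 G) * eF - X 0 * h
  obtain ⟨F', G', c, hrel, rfl, rfl⟩ := UniqueFactorizationMonoid.exists_reduced_factors F hF0 G
  have hc : c ≠ 0 := left_ne_zero_of_mul hF0
  have key' : ∀ i, G' * pderiv i F' = F' * pderiv i G' := by
    intro i
    have := key i
    simp only [pderiv_mul] at this
    refine mul_left_cancel₀ (pow_ne_zero 2 hc) ?_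
    linear_combination this
  refine ⟨c, coeff 0 F', coeff 0 G', ?_, ?_⟩
  · rw [← eq_C_of_dvd_pderiv fun i => hrel.dvd_of_dvd_mul_left ⟨_, key' i⟩, mul_comm]
  · rw [← eq_C_of_dvd_pderiv fun i => hrel.symm.dvd_of_dvd_mul_left ⟨_, (key' i).symm⟩, mul_comm]

theorem jac_aeval (p q U V : MvPolynomial (Fin 2) ℂ) :
    jac (aeval ![U, V] p) (aeval ![U, V] q) = aeval ![U, V] (jac p q) * jac U V := by
  have chain : ∀ (i : Fin 2) (r : MvPolynomial (Fin 2) ℂ), pderiv i (aeval ![U, V] r) =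
      aeval ![U, V] (pderiv 0 r) * pderiv i U + aeval ![U, V] (pderiv 1 r) * pderiv i V := by
    intro i r
    induction r using MvPolynomial.induction_on with
    | C a => simp [algebraMap_eq]
    | add p q hp hq => simp only [map_add, hp, hq]; ring
    | mul_X p j hp =>
      rw [map_mul, pderiv_mul, hp]
      fin_cases j <;> simp [pderiv_X] <;> ring
  simp only [jac, chain, map_sub, map_mul]
  ring

theorem homogeneousComponent_mul_of_totalDegree_le {σ : Type*} {p q : MvPolynomial σ ℂ} {m n : ℕ}
    (hp : p.totalDegree ≤ m) (hq : q.totalDegree ≤ n) :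
    homogeneousComponent (m + n) (p * q) =
      homogeneousComponent m p * homogeneousComponent n q := by
  classical
  ext d
  rw [coeff_homogeneousComponent]
  split_ifs with hd
  · rw [coeff_mul, coeff_mul]
    refine Finset.sum_congr rfl fun ⟨a, b⟩ hab => ?_
    rw [Finset.HasAntidiagonal.mem_antidiagonal] at hab
    have hdeg : a.degree + b.degree = m + n := by rw [← hd, ← hab]; simp
    simp only [coeff_homogeneousComponent]
    by_cases ha : a.degree = m
    · have hb : b.degree = n := by omega
      simp [ha, hb]
    · have : m < a.degree ∨ n < b.degree := by omega
      rcases this with h | h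
      · rw [coeff_eq_zero_of_totalDegree_lt (d := a) (by
          exact lt_of_le_of_lt hp (by simpa [Finsupp.degree_apply] using h))]
        simp
      · rw [coeff_eq_zero_of_totalDegree_lt (d := b) (by
          exact lt_of_le_of_lt hq (by simpa [Finsupp.degree_apply] using h))]
        simp
  · exact ((((homogeneousComponent_isHomogeneous m p).mul
      (homogeneousComponent_isHomogeneous n q))).coeff_eq_zero hd).symm

theorem homogeneousComponent_pderiv {σ : Type*} (i : σ) (n : ℕ) (p : MvPolynomial σ ℂ) :
    homogeneousComponent n (pderiv i p) = pderiv i (homogeneousComponent (n + 1) p) := by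
  classical
  ext d
  simp only [coeff_homogeneousComponent, coeff_pderiv]
  have : (d + Finsupp.single i 1).degree = d.degree + 1 := by simp
  simp [this]

theorem homogeneousComponent_aeval {σ : Type*} {f : σ → MvPolynomial σ ℂ}
    (hf : ∀ i, (f i).IsHomogeneous 1) (n : ℕ) (p : MvPolynomial σ ℂ) :
    homogeneousComponent n (aeval f p) = aeval f (homogeneousComponent n p) := by
  classical
  have hom : ∀ k, (aeval f (homogeneousComponent k p)).IsHomogeneous k := fun k => by
    simpa using (homogeneousComponent_isHomogeneous k p).aeval f hf
  conv_lhs => rw [← sum_homogeneousComponent p]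
  rw [map_sum, map_sum]
  simp only [homogeneousComponent_of_mem (hom _)]
  rw [Finset.sum_ite_eq]
  split_ifs with h
  · rfl
  · rw [homogeneousComponent_eq_zero n p (by simpa using h), map_zero]

theorem homogeneousComponent_totalDegree_ne_zero {σ : Type*} {p : MvPolynomial σ ℂ} {m : ℕ}
    (hm : m = p.totalDegree) (h0 : m ≠ 0) : homogeneousComponent m p ≠ 0 := by
  have hp : p.support.Nonempty := by
    rw [Finset.nonempty_iff_ne_empty, Ne, support_eq_empty]
    rintro rfl
    exact h0 (by simpa using hm)
  obtain ⟨d, hd, hdeg⟩ := Finset.exists_mem_eq_sup p.support hp fun s => s.sum fun _ e => e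
  intro h
  have hc := congrArg (coeff d) h
  have hdm : d.degree = m := (hm.trans hdeg).symm
  rw [coeff_homogeneousComponent, if_pos hdm, coeff_zero] at hc
  exact mem_support_iff.mp hd hc

local notation "𝐱" => Ideal.Quotient.mk Id4 (X 0)
local notation "𝐲" => Ideal.Quotient.mk Id4 (X 1)
local notation "𝐳" => Ideal.Quotient.mk Id4 (X 2)

/-- The quartic invariant `U² V²` of the quaternion group. -/
def invX (U V : MvPolynomial (Fin 2) ℂ) : MvPolynomial (Fin 2) ℂ := U ^ 2 * V ^ 2

/-- The quartic invariant of the quaternion group proportional to `U⁴ + V⁴`. -/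
def invY (U V : MvPolynomial (Fin 2) ℂ) : MvPolynomial (Fin 2) ℂ :=
  C (-Complex.I / 2) * (U ^ 4 + V ^ 4)

/-- The sextic invariant of the quaternion group proportional to `U V (U⁴ - V⁴)`. -/
def invZ (U V : MvPolynomial (Fin 2) ℂ) : MvPolynomial (Fin 2) ℂ :=
  C (1 / 2) * (U * V * (U ^ 4 - V ^ 4))

theorem C_I_sq {σ : Type*} : (C Complex.I : MvPolynomial σ ℂ) ^ 2 = -1 := by
  rw [← C_pow, Complex.I_sq]; simp

theorem C_half_mul_two {σ : Type*} : (C (1 / 2) : MvPolynomial σ ℂ) * 2 = 1 := by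
  rw [← map_ofNat (C : ℂ →+* MvPolynomial σ ℂ) 2, ← C_mul]; norm_num

theorem C_neg_I_div_two {σ : Type*} :
    (C (-Complex.I / 2) : MvPolynomial σ ℂ) = -(C Complex.I * C (1 / 2)) := by
  rw [← C_mul, ← C_neg]; congr 1; ring

theorem inv_relation (U V : MvPolynomial (Fin 2) ℂ) :
    invX U V ^ 3 + invX U V * invY U V ^ 2 + invZ U V ^ 2 = 0 := by
  simp only [invX, invY, invZ, C_neg_I_div_two]
  have h1 := C_I_sq (σ := Fin 2)
  have h2 := C_half_mul_two (σ := Fin 2)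
  linear_combination (U ^ 2 * V ^ 2 * C (1 / 2) ^ 2 * (U ^ 4 + V ^ 4) ^ 2) * h1 -
    (U ^ 6 * V ^ 6) * (C (1 / 2) * 2 + 1) * h2

/-- The embedding of the coordinate ring of the Klein surface as quaternion invariants. -/
def kleinEmb : Ad4 →ₐ[ℂ] MvPolynomial (Fin 2) ℂ :=
  Ideal.Quotient.liftₐ Id4
    (aeval ![invX (X 0) (X 1), invY (X 0) (X 1), invZ (X 0) (X 1)]) (by
      intro a ha
      obtain ⟨b, rfl⟩ := Ideal.mem_span_singleton'.mp ha
      rw [map_mul]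
      simp only [map_add, map_mul, map_pow, aeval_X]
      exact mul_eq_zero_of_right _ (inv_relation _ _))

theorem kleinEmb_x : kleinEmb 𝐱 = invX (X 0) (X 1) := by
  change aeval _ (X 0) = _
  simp

theorem kleinEmb_y : kleinEmb 𝐲 = invY (X 0) (X 1) := by
  change aeval _ (X 1) = _
  simp

theorem kleinEmb_z : kleinEmb 𝐳 = invZ (X 0) (X 1) := by
  change aeval _ (X 2) = _
  simp

theorem klein_relation : (𝐱 : Ad4) ^ 3 + 𝐱 * 𝐲 ^ 2 + 𝐳 ^ 2 = 0 := by
  simp only [← map_pow, ← map_mul, ← map_add]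
  exact Ideal.Quotient.eq_zero_iff_mem.mpr (Ideal.subset_span rfl)

theorem klein_induction {P : Ad4 → Prop} (hC : ∀ c, P (algebraMap ℂ Ad4 c))
    (hadd : ∀ a b, P a → P b → P (a + b)) (hx : ∀ a, P a → P (a * 𝐱))
    (hy : ∀ a, P a → P (a * 𝐲)) (hz : ∀ a, P a → P (a * 𝐳)) (a : Ad4) : P a := by
  obtain ⟨p, rfl⟩ := Ideal.Quotient.mk_surjective a
  induction p using MvPolynomial.induction_on with
  | C c => exact hC c
  | add p q hp hq => rw [map_add]; exact hadd _ _ hp hq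
  | mul_X p i hp =>
    rw [map_mul]
    fin_cases i
    · exact hx _ hp
    · exact hy _ hp
    · exact hz _ hp

theorem klein_algHom_ext {R : Type*} [CommRing R] [Algebra ℂ R] {f g : Ad4 →ₐ[ℂ] R}
    (hx : f 𝐱 = g 𝐱) (hy : f 𝐲 = g 𝐲) (hz : f 𝐳 = g 𝐳) : f = g := by
  ext a
  induction a using klein_induction with
  | hC c => simp only [AlgHom.commutes]
  | hadd a b ha hb => rw [map_add, map_add, ha, hb]
  | hx a ha => rw [map_mul, map_mul, ha, hx]
  | hy a ha => rw [map_mul, map_mul, ha, hy]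
  | hz a ha => rw [map_mul, map_mul, ha, hz]

theorem klein_exists_constant_add (a : Ad4) :
    ∃ (c : ℂ) (r s t : Ad4), a = algebraMap ℂ Ad4 c + 𝐱 * r + 𝐲 * s + 𝐳 * t := by
  induction a using klein_induction with
  | hC c => exact ⟨c, 0, 0, 0, by ring⟩
  | hadd a b ha hb =>
    obtain ⟨c, r, s, t, rfl⟩ := ha
    obtain ⟨c', r', s', t', rfl⟩ := hb
    exact ⟨c + c', r + r', s + s', t + t', by rw [map_add]; ring⟩
  | hx a ha => exact ⟨0, a, 0, 0, by rw [map_zero]; ring⟩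
  | hy a ha => exact ⟨0, 0, a, 0, by rw [map_zero]; ring⟩
  | hz a ha => exact ⟨0, 0, 0, a, by rw [map_zero]; ring⟩

theorem klein_normal_form (a : Ad4) :
    ∃ p q : MvPolynomial (Fin 2) ℂ, a = aeval ![𝐱, 𝐲] p + 𝐳 * aeval ![𝐱, 𝐲] q := by
  induction a using klein_induction with
  | hC c => exact ⟨C c, 0, by simp⟩
  | hadd a b ha hb =>
    obtain ⟨p, q, rfl⟩ := ha
    obtain ⟨p', q', rfl⟩ := hb
    exact ⟨p + p', q + q', by rw [map_add, map_add]; ring⟩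
  | hx a ha =>
    obtain ⟨p, q, rfl⟩ := ha
    exact ⟨p * X 0, q * X 0, by simp only [map_mul, aeval_X, Matrix.cons_val_zero]; ring⟩
  | hy a ha =>
    obtain ⟨p, q, rfl⟩ := ha
    refine ⟨p * X 1, q * X 1, ?_⟩
    simp only [map_mul, aeval_X, Matrix.cons_val_one, Matrix.cons_val_zero]
    ring
  | hz a ha =>
    obtain ⟨p, q, rfl⟩ := ha
    refine ⟨-(q * (X 0 ^ 3 + X 0 * X 1 ^ 2)), p, ?_⟩
    simp only [map_neg, map_mul, map_add, map_pow, aeval_X, Matrix.cons_val_zero,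
      Matrix.cons_val_one]
    linear_combination (aeval ![𝐱, 𝐲] q) * klein_relation

theorem exists_invariants_eq (x y : ℂ) :
    ∃ u v : ℂ, u ^ 2 * v ^ 2 = x ∧ -Complex.I / 2 * (u ^ 4 + v ^ 4) = y := by
  have hI := Complex.I_sq
  set w := 2 * Complex.I * y with hw
  obtain ⟨d, hd⟩ := IsAlgClosed.exists_pow_nat_eq (w ^ 2 - 4 * x ^ 2) (n := 2) (by norm_num)
  obtain ⟨u, hu⟩ := IsAlgClosed.exists_pow_nat_eq ((w + d) / 2) (n := 4) (by norm_num)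
  obtain ⟨v, hv⟩ := IsAlgClosed.exists_pow_nat_eq ((w - d) / 2) (n := 4) (by norm_num)
  have hsum : -Complex.I / 2 * (u ^ 4 + v ^ 4) = y := by
    rw [hu, hv, hw]; linear_combination -y * hI
  have hsq : (u ^ 2 * v ^ 2) ^ 2 = x ^ 2 := by
    have : (u ^ 2 * v ^ 2) ^ 2 = u ^ 4 * v ^ 4 := by ring
    rw [this, hu, hv]; linear_combination -(1 / 4 : ℂ) * hd
  rcases sq_eq_sq_iff_eq_or_eq_neg.mp hsq with h | h
  · exact ⟨u, v, h, hsum⟩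
  · refine ⟨u, Complex.I * v, ?_, ?_⟩
    · linear_combination -h + u ^ 2 * v ^ 2 * hI
    · rw [mul_pow, Complex.I_pow_four, one_mul, hsum]

theorem kleinEmb_injective : Function.Injective kleinEmb := by
  rw [injective_iff_map_eq_zero]
  intro a ha
  obtain ⟨p, q, rfl⟩ := klein_normal_form a
  have hev : ∀ u v : ℂ,
      eval ![u ^ 2 * v ^ 2, -Complex.I / 2 * (u ^ 4 + v ^ 4)] p +
        (1 / 2 * (u * v * (u ^ 4 - v ^ 4))) *
          eval ![u ^ 2 * v ^ 2, -Complex.I / 2 * (u ^ 4 + v ^ 4)] q = 0 := by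
    intro u v
    have hcomp : ∀ r : MvPolynomial (Fin 2) ℂ,
        eval ![u, v] (kleinEmb (aeval ![𝐱, 𝐲] r)) =
          eval ![u ^ 2 * v ^ 2, -Complex.I / 2 * (u ^ 4 + v ^ 4)] r := by
      intro r
      induction r using MvPolynomial.induction_on with
      | C c =>
        rw [← algebraMap_eq, AlgHom.commutes, AlgHom.commutes, algebraMap_eq, eval_C, eval_C]
      | add r s hr hs => simp only [map_add, hr, hs]
      | mul_X r i hr =>
        rw [map_mul, map_mul, map_mul, hr, map_mul, aeval_X, eval_X]
        fin_cases i
        · simp [kleinEmb_x, invX]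
        · simp [kleinEmb_y, invY]
    have h := congrArg (eval ![u, v]) ha
    rw [map_add, map_add, map_mul, map_mul, hcomp, hcomp, kleinEmb_z] at h
    simpa [invZ] using h
  have hboth : ∀ x y : ℂ, eval ![x, y] p = 0 ∧ eval ![x, y] (q * (X 0 ^ 3 + X 0 * X 1 ^ 2)) = 0 := by
    intro x y
    obtain ⟨u, v, rfl, rfl⟩ := exists_invariants_eq x y
    have h1 := hev u v
    have h2 := hev v u
    rw [mul_comm (v ^ 2), add_comm (v ^ 4)] at h2
    refine ⟨by linear_combination (h1 + h2) / 2, ?_⟩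
    simp only [map_mul, map_add, map_pow, eval_X, Matrix.cons_val_zero, Matrix.cons_val_one]
    linear_combination (-(1 / 4 : ℂ) * (u * v * (u ^ 4 - v ^ 4))) * (h1 - h2) +
      u ^ 2 * v ^ 2 * (u ^ 4 + v ^ 4) ^ 2 / 4 *
        (eval ![u ^ 2 * v ^ 2, -Complex.I / 2 * (u ^ 4 + v ^ 4)] q) * Complex.I_sq
  have hvec : ∀ w : Fin 2 → ℂ, w = ![w 0, w 1] := fun w => by
    ext i; fin_cases i <;> rfl
  have hp : p = 0 := MvPolynomial.funext fun w => by
    rw [hvec w, (hboth _ _).1, map_zero]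
  have hq : q * (X 0 ^ 3 + X 0 * X 1 ^ 2) = 0 := MvPolynomial.funext fun w => by
    rw [hvec w, (hboth _ _).2, map_zero]
  have hne : (X 0 ^ 3 + X 0 * X 1 ^ 2 : MvPolynomial (Fin 2) ℂ) ≠ 0 := fun h => by
    have := congrArg (eval ![1, 0]) h
    simp at this
  rw [hp, (mul_eq_zero.mp hq).resolve_right hne]
  simp

theorem degreeOf_eq_zero_of_dvd_octic {i j : Fin 2} (hij : j ≠ i) (a b : ℂ)
    {h : MvPolynomial (Fin 2) ℂ} (hd : h ∣ X i ^ 8 + C a * X i ^ 4 + C b) :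
    h.degreeOf j = 0 := by
  have hne : (X i ^ 8 + C a * X i ^ 4 + C b : MvPolynomial (Fin 2) ℂ) ≠ 0 := by
    intro h0
    have hev : ∀ t : ℂ, t ^ 8 + a * t ^ 4 + b = 0 := fun t => by
      simpa using congrArg (eval fun _ => t) h0
    have h : (240 : ℂ) = 0 := by linear_combination hev 2 - 16 * hev 1 + 15 * hev 0
    norm_num at h
  have hdeg : (X i ^ 8 + C a * X i ^ 4 + C b : MvPolynomial (Fin 2) ℂ).degreeOf j = 0 := by
    refine Nat.le_zero.mp ((degreeOf_add_le _ _ _).trans (max_le ?_ (by simp)))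
    refine (degreeOf_add_le _ _ _).trans (max_le ?_ ?_)
    · rw [degreeOf_X_pow_of_ne _ hij]
    · refine (degreeOf_C_mul_le _ _ _).trans ?_
      rw [degreeOf_X_pow_of_ne _ hij]
  obtain ⟨k, hk⟩ := hd
  rw [hk] at hne hdeg
  rw [degreeOf_mul_eq (left_ne_zero_of_mul hne) (right_ne_zero_of_mul hne)] at hdeg
  omega

theorem isUnit_of_dvd_invariants {h : MvPolynomial (Fin 2) ℂ} (h0 : h ≠ 0) (x y : ℂ)
    (hx : h ∣ invX (X 0) (X 1) - C x) (hy : h ∣ invY (X 0) (X 1) - C y) : IsUnit h := by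
  have hI : (C Complex.I : MvPolynomial (Fin 2) ℂ) ^ 2 = -1 := C_I_sq
  have h2 := C_half_mul_two (σ := Fin 2)
  have hoct : ∀ i, h ∣ X i ^ 8 + C (-(2 * Complex.I * y)) * X i ^ 4 + C (x ^ 2) := by
    have e0 : (X 0 ^ 8 + C (-(2 * Complex.I * y)) * X 0 ^ 4 + C (x ^ 2) :
        MvPolynomial (Fin 2) ℂ) =
        (invY (X 0) (X 1) - C y) * (2 * C Complex.I * X 0 ^ 4) -
          (invX (X 0) (X 1) - C x) * (X 0 ^ 2 * X 1 ^ 2 + C x) := by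
      simp only [invX, invY, C_neg_I_div_two, C_neg, C_mul, C_pow, map_ofNat]
      linear_combination X 0 ^ 4 * (X 0 ^ 4 + X 1 ^ 4) * (-h2 + 2 * C (1 / 2) * hI)
    have e1 : (X 1 ^ 8 + C (-(2 * Complex.I * y)) * X 1 ^ 4 + C (x ^ 2) :
        MvPolynomial (Fin 2) ℂ) =
        (invY (X 0) (X 1) - C y) * (2 * C Complex.I * X 1 ^ 4) -
          (invX (X 0) (X 1) - C x) * (X 0 ^ 2 * X 1 ^ 2 + C x) := by
      simp only [invX, invY, C_neg_I_div_two, C_neg, C_mul, C_pow, map_ofNat]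
      linear_combination X 1 ^ 4 * (X 0 ^ 4 + X 1 ^ 4) * (-h2 + 2 * C (1 / 2) * hI)
    intro i
    fin_cases i
    · exact e0 ▸ dvd_sub (hy.mul_right _) (hx.mul_right _)
    · exact e1 ▸ dvd_sub (hy.mul_right _) (hx.mul_right _)
  have hC : h = C (coeff 0 h) := by
    classical
    rw [← vars_eq_empty_iff_eq_C, Finset.eq_empty_iff_forall_notMem]
    intro i hi
    rw [vars_def, Multiset.mem_toFinset, ← Multiset.count_ne_zero, ← degreeOf_def] at hi
    fin_cases i
    · exact hi (degreeOf_eq_zero_of_dvd_octic (i := 1) (by decide) _ _ (hoct 1))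
    · exact hi (degreeOf_eq_zero_of_dvd_octic (i := 0) (by decide) _ _ (hoct 0))
  rw [hC] at h0 ⊢
  exact (isUnit_iff_ne_zero.mpr fun hz => h0 (by rw [hz, C_0])).map C

theorem kleinEmb_aut_relation (φ : Ad4 ≃ₐ[ℂ] Ad4) :
    kleinEmb (φ 𝐱) ^ 3 + kleinEmb (φ 𝐱) * kleinEmb (φ 𝐲) ^ 2 + kleinEmb (φ 𝐳) ^ 2 = 0 := by
  simpa only [map_add, map_mul, map_pow, map_zero] using
    congrArg (fun a => kleinEmb (φ a)) klein_relation

theorem klein_z_ne_zero : (𝐳 : Ad4) ≠ 0 := by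
  intro h
  have := congrArg (fun a => eval ![1, 2] (kleinEmb a)) h
  simp only [kleinEmb_z] at this
  norm_num [invZ] at this

theorem not_prime_of_dvd_kleinEmb_aut (φ : Ad4 ≃ₐ[ℂ] Ad4) {h : MvPolynomial (Fin 2) ℂ}
    (hx : h ∣ kleinEmb (φ 𝐱)) (hy : h ∣ kleinEmb (φ 𝐲)) : ¬ Prime h := by
  intro hp
  have hz : h ∣ kleinEmb (φ 𝐳) := by
    refine hp.dvd_of_dvd_pow (n := 2) ?_
    rw [← dvd_add_right (b := kleinEmb (φ 𝐱) ^ 3 + kleinEmb (φ 𝐱) * kleinEmb (φ 𝐲) ^ 2)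
      (dvd_add (dvd_pow hx (by norm_num)) (hx.mul_right _)), kleinEmb_aut_relation]
    exact dvd_zero h
  have hdvd : ∀ a, ∃ c, h ∣ kleinEmb a - C c := by
    intro a
    obtain ⟨c, r, s, t, hc⟩ := klein_exists_constant_add (φ.symm a)
    refine ⟨c, ?_⟩
    have : kleinEmb a - C c = kleinEmb (φ 𝐱) * kleinEmb (φ r) + kleinEmb (φ 𝐲) * kleinEmb (φ s) +
        kleinEmb (φ 𝐳) * kleinEmb (φ t) := by
      have e := congrArg (fun b => kleinEmb (φ b)) hc
      simp only [AlgEquiv.apply_symm_apply, map_add, map_mul, AlgEquiv.commutes,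
        AlgHom.commutes, algebraMap_eq] at e
      rw [e]
      ring
    rw [this]
    exact dvd_add (dvd_add (hx.mul_right _) (hy.mul_right _)) (hz.mul_right _)
  obtain ⟨c, hc⟩ := hdvd 𝐱
  obtain ⟨d, hd⟩ := hdvd 𝐲
  rw [kleinEmb_x] at hc
  rw [kleinEmb_y] at hd
  exact hp.not_isUnit (isUnit_of_dvd_invariants hp.ne_zero c d hc hd)

/-- Every automorphism of the Klein surface lifts to the affine plane. -/
theorem exists_lift (φ : Ad4 ≃ₐ[ℂ] Ad4) : ∃ U V : MvPolynomial (Fin 2) ℂ,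
    kleinEmb (φ 𝐱) = invX U V ∧ kleinEmb (φ 𝐲) = invY U V ∧ kleinEmb (φ 𝐳) = invZ U V := by
  have hI : (C Complex.I : MvPolynomial (Fin 2) ℂ) ^ 2 = -1 := C_I_sq
  have h2 := C_half_mul_two (σ := Fin 2)
  have hIn0 : (C Complex.I : MvPolynomial (Fin 2) ℂ) ≠ 0 := by simp
  have hrel := kleinEmb_aut_relation φ
  have hnp := fun h => not_prime_of_dvd_kleinEmb_aut φ (h := h)
  have hz0 : kleinEmb (φ 𝐳) ≠ 0 := fun h =>
    klein_z_ne_zero ((map_eq_zero_iff φ φ.injective).mp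
      ((map_eq_zero_iff kleinEmb kleinEmb_injective).mp h))
  generalize kleinEmb (φ 𝐱) = x at *
  generalize kleinEmb (φ 𝐲) = y at *
  generalize kleinEmb (φ 𝐳) = z at *
  have hdvd : ∀ h p, Prime h → h ∣ C p * y → p ≠ 0 → h ∣ y := by
    intro h p _ hd hp0
    have := hd.mul_left (C p⁻¹)
    rwa [← mul_assoc, ← C_mul, inv_mul_cancel₀ hp0, C_1, one_mul] at this
  have hprod : x * ((x + C Complex.I * y) * (x - C Complex.I * y)) = (C Complex.I * z) ^ 2 := by
    linear_combination hrel - (x * y ^ 2 + z ^ 2) * hI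
  have hne : x * ((x + C Complex.I * y) * (x - C Complex.I * y)) ≠ 0 := by
    rw [hprod]
    exact pow_ne_zero _ (mul_ne_zero hIn0 hz0)
  have hx0 := left_ne_zero_of_mul hne
  have hp0 := left_ne_zero_of_mul (right_ne_zero_of_mul hne)
  have r12 : IsRelPrime x (x + C Complex.I * y) :=
    (UniqueFactorizationMonoid.isRelPrime_iff_no_prime_factors hx0).mpr fun h h1 h2 hp =>
      hnp h h1 (hdvd h _ hp ((dvd_add_right h1).mp h2) Complex.I_ne_zero) hp
  have r13 : IsRelPrime x (x - C Complex.I * y) :=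
    (UniqueFactorizationMonoid.isRelPrime_iff_no_prime_factors hx0).mpr fun h h1 h2 hp =>
      hnp h h1 (hdvd h _ hp ((dvd_sub_right h1).mp h2) Complex.I_ne_zero) hp
  have r23 : IsRelPrime (x + C Complex.I * y) (x - C Complex.I * y) :=
    (UniqueFactorizationMonoid.isRelPrime_iff_no_prime_factors hp0).mpr fun h h1 h3 hp => by
      have hx : h ∣ x := by
        have : x = C (1 / 2) * ((x + C Complex.I * y) + (x - C Complex.I * y)) := by
          linear_combination -x * h2
        rw [this]
        exact (dvd_add h1 h3).mul_left _
      exact hnp h hx (hdvd h _ hp ((dvd_add_right hx).mp h1) Complex.I_ne_zero) hp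
  obtain ⟨P, hP⟩ := exists_eq_sq_of_isRelPrime (r12.mul_right r13) hprod
  obtain ⟨Q, hQ⟩ := exists_eq_sq_of_isRelPrime (b := x * (x - C Complex.I * y))
    (r12.symm.mul_right r23) (by rw [← hprod]; ring)
  obtain ⟨R, hR⟩ := exists_eq_sq_of_isRelPrime (b := x * (x + C Complex.I * y))
    (r13.symm.mul_right r23.symm) (by rw [← hprod]; ring)
  obtain ⟨s, hs⟩ := IsAlgClosed.exists_pow_nat_eq (2 : ℂ) (n := 2) (by norm_num)
  have hs' : (C s : MvPolynomial (Fin 2) ℂ) ^ 2 = 2 := by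
    rw [← C_pow, hs, map_ofNat]
  have hMN : (Q + C Complex.I * R) * (Q - C Complex.I * R) = (C s * P) ^ 2 := by
    linear_combination -hQ - hR + 2 * hP - R ^ 2 * hI - P ^ 2 * hs'
  have hM0 : Q + C Complex.I * R ≠ 0 := by
    refine left_ne_zero_of_mul (b := Q - C Complex.I * R) ?_
    rw [hMN, mul_pow, hs', ← hP]
    exact mul_ne_zero two_ne_zero hx0
  have rMN : IsRelPrime (Q + C Complex.I * R) (Q - C Complex.I * R) := by
    refine (UniqueFactorizationMonoid.isRelPrime_iff_no_prime_factors hM0).mpr fun h h1 h3 hp => ?_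
    have hdQ : h ∣ Q := by
      have : Q = C (1 / 2) * ((Q + C Complex.I * R) + (Q - C Complex.I * R)) := by
        linear_combination -Q * h2
      rw [this]
      exact (dvd_add h1 h3).mul_left _
    have hdR : h ∣ R := by
      have : R = -C (1 / 2) * C Complex.I * ((Q + C Complex.I * R) - (Q - C Complex.I * R)) := by
        linear_combination -R * h2 + 2 * C (1 / 2) * R * hI
      rw [this]
      exact (dvd_sub h1 h3).mul_left _
    exact hp.not_isUnit (r23 (hQ ▸ dvd_pow hdQ two_ne_zero) (hR ▸ dvd_pow hdR two_ne_zero))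
  obtain ⟨M, hM⟩ := exists_eq_sq_of_isRelPrime rMN hMN
  obtain ⟨N, hN⟩ := exists_eq_sq_of_isRelPrime rMN.symm (by rw [mul_comm]; exact hMN)
  obtain ⟨t, ht⟩ := IsAlgClosed.exists_pow_nat_eq (1 / 2 : ℂ) (n := 4) (by norm_num)
  have ht' : (C t : MvPolynomial (Fin 2) ℂ) ^ 4 = C (1 / 2) := by rw [← C_pow, ht]
  have eX : x = invX (C t * M) (C t * N) := by
    rw [invX]
    linear_combination hP - P ^ 2 * h2 - C (1 / 2) * P ^ 2 * hs' - C (1 / 2) * hMN +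
      C (1 / 2) * ((Q - C Complex.I * R) * hM + M ^ 2 * hN) - M ^ 2 * N ^ 2 * ht'
  have eY : y = invY (C t * M) (C t * N) := by
    rw [invY, C_neg_I_div_two]
    linear_combination -y * h2 + 2 * C (1 / 2) * y * hI - C (1 / 2) * C Complex.I * (hQ - hR) +
      C (1 / 2) * C Complex.I * ((M ^ 4 + N ^ 4) * ht' -
        C (1 / 2) * ((Q + C Complex.I * R + M ^ 2) * hM + (Q - C Complex.I * R + N ^ 2) * hN) +
        (Q ^ 2 - R ^ 2) * h2 + 2 * C (1 / 2) * R ^ 2 * hI)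
  have eZ : z ^ 2 = invZ (C t * M) (C t * N) ^ 2 := by
    have := inv_relation (C t * M) (C t * N)
    rw [← eX, ← eY] at this
    linear_combination hrel - this
  rcases sq_eq_sq_iff_eq_or_eq_neg.mp eZ with h | h
  · exact ⟨_, _, eX, eY, h⟩
  · refine ⟨C t * N, C t * M, ?_, ?_, ?_⟩
    · rw [eX, invX, invX]; ring
    · rw [eY, invY, invY]; ring
    · rw [h, invZ, invZ]; ring

/-- The pair `(U, V)` defines an endomorphism of the plane lying over the automorphism `φ`. -/
def IsLift (φ : Ad4 ≃ₐ[ℂ] Ad4) (U V : MvPolynomial (Fin 2) ℂ) : Prop :=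
  ∀ a, aeval ![U, V] (kleinEmb a) = kleinEmb (φ a)

theorem aeval_kleinEmb_eq {f : MvPolynomial (Fin 2) ℂ →ₐ[ℂ] MvPolynomial (Fin 2) ℂ}
    {ψ : Ad4 →ₐ[ℂ] MvPolynomial (Fin 2) ℂ}
    (hx : invX (f (X 0)) (f (X 1)) = ψ 𝐱) (hy : invY (f (X 0)) (f (X 1)) = ψ 𝐲)
    (hz : invZ (f (X 0)) (f (X 1)) = ψ 𝐳) (a : Ad4) : f (kleinEmb a) = ψ a := by
  have hfC : ∀ c, f (C c) = C c := fun c => f.commutes c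
  refine DFunLike.congr_fun (klein_algHom_ext (f := f.comp kleinEmb) (g := ψ) ?_ ?_ ?_) a
  · rw [AlgHom.comp_apply, kleinEmb_x, ← hx]
    simp only [invX, map_mul, map_pow]
  · rw [AlgHom.comp_apply, kleinEmb_y, ← hy]
    simp only [invY, map_mul, map_pow, map_add, hfC]
  · rw [AlgHom.comp_apply, kleinEmb_z, ← hz]
    simp only [invZ, map_mul, map_pow, map_sub, hfC]

theorem exists_isLift (φ : Ad4 ≃ₐ[ℂ] Ad4) : ∃ U V, IsLift φ U V := by
  obtain ⟨U, V, hx, hy, hz⟩ := exists_lift φ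
  refine ⟨U, V, fun a => ?_⟩
  exact aeval_kleinEmb_eq (ψ := kleinEmb.comp (φ : Ad4 →ₐ[ℂ] Ad4))
    (by simpa using hx.symm) (by simpa using hy.symm) (by simpa using hz.symm) a

namespace IsLift

variable {φ : Ad4 ≃ₐ[ℂ] Ad4} {U V : MvPolynomial (Fin 2) ℂ}

theorem map_x (h : IsLift φ U V) : kleinEmb (φ 𝐱) = invX U V := by
  rw [← h, kleinEmb_x]
  simp [invX]

theorem map_y (h : IsLift φ U V) : kleinEmb (φ 𝐲) = invY U V := by
  rw [← h, kleinEmb_y]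
  simp [invY]

theorem map_z (h : IsLift φ U V) : kleinEmb (φ 𝐳) = invZ U V := by
  rw [← h, kleinEmb_z]
  simp [invZ]

theorem isUnit_jac (h : IsLift φ U V) : IsUnit (jac U V) := by
  obtain ⟨U', V', h'⟩ := exists_isLift φ.symm
  have hid : ∀ a, aeval ![U, V] (aeval ![U', V'] (kleinEmb a)) = kleinEmb a := fun a => by
    rw [h', h, AlgEquiv.apply_symm_apply]
  have hJ : jac (kleinEmb 𝐱) (kleinEmb 𝐲) = kleinEmb (algebraMap ℂ Ad4 (8 * Complex.I) * 𝐳) := by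
    rw [map_mul, AlgHom.commutes, kleinEmb_x, kleinEmb_y, kleinEmb_z, algebraMap_eq, C_mul,
      map_ofNat]
    have h2 := C_half_mul_two (σ := Fin 2)
    simp only [jac, invX, invY, invZ, C_neg_I_div_two, pderiv_mul, pderiv_pow, map_add, map_neg,
      pderiv_C, pderiv_X_self, pderiv_X_of_ne (show (1 : Fin 2) ≠ 0 by decide),
      pderiv_X_of_ne (show (0 : Fin 2) ≠ 1 by decide)]
    push_cast
    ring
  have hne : jac (kleinEmb 𝐱) (kleinEmb 𝐲) ≠ 0 := by
    rw [hJ, map_mul, AlgHom.commutes, algebraMap_eq]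
    refine mul_ne_zero (by simp) fun h0 => klein_z_ne_zero (kleinEmb_injective ?_)
    rw [h0, map_zero]
  have hmul : jac (kleinEmb 𝐱) (kleinEmb 𝐲) * (aeval ![U, V] (jac U' V') * jac U V) =
      jac (kleinEmb 𝐱) (kleinEmb 𝐲) * 1 := by
    rw [mul_one]
    conv_rhs => rw [← hid 𝐱, ← hid 𝐲, jac_aeval, jac_aeval, map_mul, hJ, hid, ← hJ]
    ring
  exact IsUnit.of_mul_eq_one_right _ (mul_left_cancel₀ hne hmul)

end IsLift

/-- The quaternion `i` acting on the plane. -/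
def quatI : MvPolynomial (Fin 2) ℂ →ₐ[ℂ] MvPolynomial (Fin 2) ℂ :=
  aeval ![C Complex.I * X 0, -(C Complex.I * X 1)]

/-- The quaternion `j` acting on the plane. -/
def quatJ : MvPolynomial (Fin 2) ℂ →ₐ[ℂ] MvPolynomial (Fin 2) ℂ :=
  aeval ![X 1, -X 0]

/-- An endomorphism of the plane over the Klein surface whose square is the central involution. -/
def IsQuaternion (g : MvPolynomial (Fin 2) ℂ →ₐ[ℂ] MvPolynomial (Fin 2) ℂ) : Prop :=
  (∀ a, g (kleinEmb a) = kleinEmb a) ∧ ∀ i, g (g (X i)) = -X i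

theorem isQuaternion_quatI : IsQuaternion quatI := by
  have hI := C_I_sq (σ := Fin 2)
  have e0 : quatI (X 0) = C Complex.I * X 0 := by simp [quatI]
  have e1 : quatI (X 1) = -(C Complex.I * X 1) := by simp [quatI]
  have eC : quatI (C Complex.I) = C Complex.I := quatI.commutes _
  refine ⟨fun a => aeval_kleinEmb_eq (ψ := kleinEmb) ?_ ?_ ?_ a, fun i => ?_⟩
  · rw [kleinEmb_x, e0, e1, invX, invX]
    linear_combination X 0 ^ 2 * X 1 ^ 2 * (C Complex.I ^ 2 - 1) * hI
  · rw [kleinEmb_y, e0, e1, invY, invY]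
    linear_combination C (-Complex.I / 2) * (X 0 ^ 4 + X 1 ^ 4) * (C Complex.I ^ 2 - 1) * hI
  · rw [kleinEmb_z, e0, e1, invZ, invZ]
    linear_combination -C (1 / 2) * X 0 * X 1 * (X 0 ^ 4 - X 1 ^ 4) *
      (C Complex.I ^ 4 - C Complex.I ^ 2 + 1) * hI
  · fin_cases i
    · simp only [Fin.zero_eta, e0, map_mul, eC]
      linear_combination X 0 * hI
    · simp only [Fin.mk_one, e1, map_neg, map_mul, eC]
      linear_combination X 1 * hI

theorem isQuaternion_quatJ : IsQuaternion quatJ := by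
  have e0 : quatJ (X 0) = X 1 := by simp [quatJ]
  have e1 : quatJ (X 1) = -X 0 := by simp [quatJ]
  refine ⟨fun a => aeval_kleinEmb_eq (ψ := kleinEmb) ?_ ?_ ?_ a, fun i => ?_⟩
  · rw [kleinEmb_x, e0, e1, invX, invX]; ring
  · rw [kleinEmb_y, e0, e1, invY, invY]; ring
  · rw [kleinEmb_z, e0, e1, invZ, invZ]; ring
  · fin_cases i
    · simp [e0, e1]
    · simp [e0, e1]

theorem isQuaternion_comp : IsQuaternion (quatI.comp quatJ) := by
  have hI := C_I_sq (σ := Fin 2)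
  refine ⟨fun a => ?_, fun i => ?_⟩
  · rw [AlgHom.comp_apply, isQuaternion_quatJ.1, isQuaternion_quatI.1]
  · have e0 : quatI.comp quatJ (X 0) = -(C Complex.I * X 1) := by simp [quatI, quatJ]
    have e1 : quatI.comp quatJ (X 1) = -(C Complex.I * X 0) := by simp [quatI, quatJ]
    have eC : quatI.comp quatJ (C Complex.I) = C Complex.I := (quatI.comp quatJ).commutes _
    fin_cases i
    · simp only [Fin.zero_eta, e0, map_neg, map_mul, eC, e1]
      linear_combination X 0 * hI
    · simp only [Fin.mk_one, e1, map_neg, map_mul, eC, e0]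
      linear_combination X 1 * hI

theorem IsQuaternion.constantCoeff_pderiv_eq_zero
    {g : MvPolynomial (Fin 2) ℂ →ₐ[ℂ] MvPolynomial (Fin 2) ℂ} (hg : IsQuaternion g)
    {p : MvPolynomial (Fin 2) ℂ} (hp : g p = p ∨ g p = -p) (i : Fin 2) :
    constantCoeff (pderiv i p) = 0 := by
  have hgg : g (g p) = p := by
    rcases hp with h | h <;> simp [h]
  have hneg : g.comp g = aeval ![-X 0, -X 1] := by
    ext1 j
    rw [AlgHom.comp_apply, hg.2]
    fin_cases j <;> simp
  have hder : ∀ q : MvPolynomial (Fin 2) ℂ,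
      pderiv i (aeval ![-X 0, -X 1] q : MvPolynomial (Fin 2) ℂ) =
        -aeval ![-X 0, -X 1] (pderiv i q) := by
    intro q
    induction q using MvPolynomial.induction_on with
    | C a => simp [algebraMap_eq]
    | add p q hp hq => simp only [map_add, hp, hq]; ring
    | mul_X p j hp =>
      rw [map_mul, pderiv_mul, hp]
      fin_cases i <;> fin_cases j <;> simp [pderiv_X] <;> ring
  have hcc : ∀ q : MvPolynomial (Fin 2) ℂ,
      constantCoeff (aeval ![-X 0, -X 1] q : MvPolynomial (Fin 2) ℂ) = constantCoeff q := by
    intro q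
    induction q using MvPolynomial.induction_on with
    | C a => simp [algebraMap_eq]
    | add p q hp hq => simp only [map_add, hp, hq]
    | mul_X p j hp =>
      rw [map_mul, map_mul, hp]
      fin_cases j <;> simp
  have h := hder p
  rw [← hneg, AlgHom.comp_apply, hgg, hneg] at h
  have h' := congrArg constantCoeff h
  rw [map_neg, hcc] at h'
  linear_combination h' / 2

/-- `A` and `B` are distinguished by the signs with which `i` or `j` act on them. -/
def Separated (A B : MvPolynomial (Fin 2) ℂ) : Prop :=
  (quatI A = A ∧ quatI B = -B) ∨ (quatI A = -A ∧ quatI B = B) ∨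
    (quatJ A = A ∧ quatJ B = -B) ∨ (quatJ A = -A ∧ quatJ B = B)

/-- The quaternion group acts on `A` through a nontrivial sign character. -/
def HasNontrivialSigns (A : MvPolynomial (Fin 2) ℂ) : Prop :=
  (quatI A = A ∧ quatJ A = -A) ∨ (quatI A = -A ∧ quatJ A = A) ∨ (quatI A = -A ∧ quatJ A = -A)

theorem homogeneousComponent_quatI (n : ℕ) (p : MvPolynomial (Fin 2) ℂ) :
    homogeneousComponent n (quatI p) = quatI (homogeneousComponent n p) := by
  refine homogeneousComponent_aeval (fun i => ?_) n p
  fin_cases i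
  · simpa using (isHomogeneous_X ℂ (0 : Fin 2)).C_mul Complex.I
  · simpa using ((isHomogeneous_X ℂ (1 : Fin 2)).C_mul Complex.I).neg

theorem homogeneousComponent_quatJ (n : ℕ) (p : MvPolynomial (Fin 2) ℂ) :
    homogeneousComponent n (quatJ p) = quatJ (homogeneousComponent n p) := by
  refine homogeneousComponent_aeval (fun i => ?_) n p
  fin_cases i
  · simpa using isHomogeneous_X ℂ (1 : Fin 2)
  · simpa using (isHomogeneous_X ℂ (0 : Fin 2)).neg

theorem Separated.eq_zero_or_eq_zero {A B T : MvPolynomial (Fin 2) ℂ} (h : Separated A B) (n : ℕ)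
    {a b : ℂ} (hA : homogeneousComponent n A = C a * T) (hB : homogeneousComponent n B = C b * T)
    (hT : T ≠ 0) : a = 0 ∨ b = 0 := by
  have aux : ∀ (g : MvPolynomial (Fin 2) ℂ →ₐ[ℂ] MvPolynomial (Fin 2) ℂ) (c d : ℂ),
      g (C c * T) = C c * T → g (C d * T) = -(C d * T) → c = 0 ∨ d = 0 := by
    intro g c d hc hd
    by_contra! hcd
    have hgC : ∀ e, g (C e) = C e := fun e => g.commutes e
    rw [map_mul, hgC] at hc hd
    have h1 := mul_left_cancel₀ (C_ne_zero.mpr hcd.1) hc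
    rw [← mul_neg] at hd
    have h2 := mul_left_cancel₀ (C_ne_zero.mpr hcd.2) hd
    exact hT (self_eq_neg.mp (h1.symm.trans h2))
  have hI := homogeneousComponent_quatI n
  have hJ := homogeneousComponent_quatJ n
  rcases h with ⟨h1, h2⟩ | ⟨h1, h2⟩ | ⟨h1, h2⟩ | ⟨h1, h2⟩
  · exact aux quatI a b (by rw [← hA, ← hI, h1]) (by rw [← hB, ← hI, h2, map_neg])
  · exact (aux quatI b a (by rw [← hB, ← hI, h2]) (by rw [← hA, ← hI, h1, map_neg])).symm
  · exact aux quatJ a b (by rw [← hA, ← hJ, h1]) (by rw [← hB, ← hJ, h2, map_neg])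
  · exact (aux quatJ b a (by rw [← hB, ← hJ, h2]) (by rw [← hA, ← hJ, h1, map_neg])).symm

theorem HasNontrivialSigns.coeff_zero {A : MvPolynomial (Fin 2) ℂ} (h : HasNontrivialSigns A) :
    coeff 0 A = 0 := by
  have hC : homogeneousComponent 0 A = C (coeff 0 A) := homogeneousComponent_zero A
  have hI := homogeneousComponent_quatI 0 A
  have hJ := homogeneousComponent_quatJ 0 A
  have eI : ∀ c, quatI (C c) = C c := fun c => quatI.commutes c
  have eJ : ∀ c, quatJ (C c) = C c := fun c => quatJ.commutes c
  rw [hC, eI] at hI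
  rw [hC, eJ] at hJ
  have key : homogeneousComponent 0 (-A) = C (coeff 0 A) → coeff 0 A = 0 := fun h => by
    rw [map_neg, hC] at h
    exact C_eq_zero.mp (self_eq_neg.mp h.symm)
  rcases h with ⟨-, h⟩ | ⟨h, -⟩ | ⟨h, -⟩
  · exact key (h ▸ hJ)
  · exact key (h ▸ hI)
  · exact key (h ▸ hI)

namespace IsLift

variable {φ : Ad4 ≃ₐ[ℂ] Ad4} {U V : MvPolynomial (Fin 2) ℂ}

theorem mul_mul_ne_zero (h : IsLift φ U V) : U * V * (U ^ 2 + V ^ 2) * (U ^ 2 - V ^ 2) ≠ 0 := by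
  have hz : kleinEmb (φ 𝐳) ≠ 0 := fun h0 =>
    klein_z_ne_zero ((map_eq_zero_iff φ φ.injective).mp
      ((map_eq_zero_iff kleinEmb kleinEmb_injective).mp h0))
  rw [h.map_z, invZ] at hz
  convert right_ne_zero_of_mul hz using 1
  ring

theorem signs (h : IsLift φ U V) {g : MvPolynomial (Fin 2) ℂ →ₐ[ℂ] MvPolynomial (Fin 2) ℂ}
    (hg : IsQuaternion g) :
    (g (U * V) = U * V ∧ g (U ^ 2 + V ^ 2) = -(U ^ 2 + V ^ 2) ∧
        g (U ^ 2 - V ^ 2) = -(U ^ 2 - V ^ 2)) ∨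
      (g (U * V) = -(U * V) ∧ g (U ^ 2 + V ^ 2) = U ^ 2 + V ^ 2 ∧
        g (U ^ 2 - V ^ 2) = -(U ^ 2 - V ^ 2)) ∨
      (g (U * V) = -(U * V) ∧ g (U ^ 2 + V ^ 2) = -(U ^ 2 + V ^ 2) ∧
        g (U ^ 2 - V ^ 2) = U ^ 2 - V ^ 2) := by
  have hgC : ∀ e, g (C e) = C e := fun e => g.commutes e
  have hx : g (U ^ 2 * V ^ 2) = U ^ 2 * V ^ 2 := by
    simpa only [h.map_x, invX] using hg.1 (φ 𝐱)
  have hy : g (U ^ 4 + V ^ 4) = U ^ 4 + V ^ 4 := by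
    have := hg.1 (φ 𝐲)
    rw [h.map_y, invY, map_mul, hgC] at this
    exact mul_left_cancel₀ (by simp) this
  have hz : g (U * V * (U ^ 4 - V ^ 4)) = U * V * (U ^ 4 - V ^ 4) := by
    have := hg.1 (φ 𝐳)
    rw [h.map_z, invZ, map_mul, hgC] at this
    exact mul_left_cancel₀ (by simp) this
  have hne := h.mul_mul_ne_zero
  have hne' : U * V * (U ^ 2 + V ^ 2) * (U ^ 2 - V ^ 2) ≠
      -(U * V * (U ^ 2 + V ^ 2) * (U ^ 2 - V ^ 2)) := fun h0 => hne (self_eq_neg.mp h0)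
  simp only [map_mul, map_add, map_sub, map_pow] at hx hy hz ⊢
  have hP : g U * g V = U * V ∨ g U * g V = -(U * V) :=
    sq_eq_sq_iff_eq_or_eq_neg.mp (by linear_combination hx)
  have hQ : g U ^ 2 + g V ^ 2 = U ^ 2 + V ^ 2 ∨ g U ^ 2 + g V ^ 2 = -(U ^ 2 + V ^ 2) :=
    sq_eq_sq_iff_eq_or_eq_neg.mp (by linear_combination hy + 2 * hx)
  have hR : g U ^ 2 - g V ^ 2 = U ^ 2 - V ^ 2 ∨ g U ^ 2 - g V ^ 2 = -(U ^ 2 - V ^ 2) :=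
    sq_eq_sq_iff_eq_or_eq_neg.mp (by linear_combination hy - 2 * hx)
  have hprod : g U * g V * (g U ^ 2 + g V ^ 2) * (g U ^ 2 - g V ^ 2) =
      U * V * (U ^ 2 + V ^ 2) * (U ^ 2 - V ^ 2) := by linear_combination hz
  rcases hP with hP | hP <;> rcases hQ with hQ | hQ <;> rcases hR with hR | hR <;>
    rw [hP, hQ, hR] at hprod
  · exfalso
    have hU : g U = U ∨ g U = -U := sq_eq_sq_iff_eq_or_eq_neg.mp
      (mul_left_cancel₀ (two_ne_zero (α := MvPolynomial (Fin 2) ℂ)) (by linear_combination hQ + hR))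
    have hV : g V = V ∨ g V = -V := sq_eq_sq_iff_eq_or_eq_neg.mp
      (mul_left_cancel₀ (two_ne_zero (α := MvPolynomial (Fin 2) ℂ)) (by linear_combination hQ - hR))
    have hunit := h.isUnit_jac.map (constantCoeff (R := ℂ) (σ := Fin 2))
    simp [jac, hg.constantCoeff_pderiv_eq_zero hU] at hunit
  · exact absurd (by linear_combination -hprod) hne'
  · exact absurd (by linear_combination -hprod) hne'
  · exact Or.inl ⟨hP, hQ, hR⟩
  · exact absurd (by linear_combination -hprod) hne'
  · exact Or.inr (Or.inl ⟨hP, hQ, hR⟩)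
  · exact Or.inr (Or.inr ⟨hP, hQ, hR⟩)
  · exact absurd (by linear_combination -hprod) hne'

theorem separated (h : IsLift φ U V) :
    (Separated (U * V) (U ^ 2 + V ^ 2) ∧ Separated (U * V) (U ^ 2 - V ^ 2) ∧
      Separated (U ^ 2 + V ^ 2) (U ^ 2 - V ^ 2)) ∧
    HasNontrivialSigns (U * V) ∧ HasNontrivialSigns (U ^ 2 + V ^ 2) ∧
      HasNontrivialSigns (U ^ 2 - V ^ 2) := by
  have hI := h.signs isQuaternion_quatI
  have hJ := h.signs isQuaternion_quatJ
  have hK := h.signs isQuaternion_comp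
  have hne := h.mul_mul_ne_zero
  have hP : U * V ≠ -(U * V) := fun h0 =>
    left_ne_zero_of_mul (left_ne_zero_of_mul hne) (self_eq_neg.mp h0)
  have hQ : U ^ 2 + V ^ 2 ≠ -(U ^ 2 + V ^ 2) := fun h0 =>
    right_ne_zero_of_mul (left_ne_zero_of_mul hne) (self_eq_neg.mp h0)
  have hK' : ¬ (quatI (quatJ (U * V)) = U * V ∧
      quatI (quatJ (U ^ 2 + V ^ 2)) = U ^ 2 + V ^ 2) := by
    rintro ⟨k1, k2⟩
    simp only [AlgHom.comp_apply, k1, k2] at hK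
    rcases hK with ⟨-, h0, -⟩ | ⟨h0, -⟩ | ⟨h0, -⟩
    exacts [hQ h0, hP h0, hP h0]
  clear hK hne hP hQ
  unfold Separated HasNontrivialSigns
  generalize U * V = P at *
  generalize U ^ 2 + V ^ 2 = Q at *
  generalize U ^ 2 - V ^ 2 = R at *
  rcases hI with ⟨i1, i2, i3⟩ | ⟨i1, i2, i3⟩ | ⟨i1, i2, i3⟩ <;>
  rcases hJ with ⟨j1, j2, j3⟩ | ⟨j1, j2, j3⟩ | ⟨j1, j2, j3⟩ <;>
  simp only [i1, i2, j1, j2, map_neg, neg_neg, and_self, not_true_eq_false] at hK' <;>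
  simp only [i1, i2, i3, j1, j2, j3, and_self, true_or, or_true]

theorem totalDegree_le_one (h : IsLift φ U V) : U.totalDegree ≤ 1 ∧ V.totalDegree ≤ 1 := by
  rw [← max_le_iff]
  by_contra! hlt
  set m := max U.totalDegree V.totalDegree with hm
  have hU : U.totalDegree ≤ m := le_max_left _ _
  have hV : V.totalDegree ≤ m := le_max_right _ _
  set F := homogeneousComponent m U with hF
  set G := homogeneousComponent m V with hG
  have hFG : F ≠ 0 ∨ G ≠ 0 := by
    rcases max_choice U.totalDegree V.totalDegree with h' | h'
    · exact Or.inl (homogeneousComponent_totalDegree_ne_zero (hm.trans h') (by omega))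
    · exact Or.inr (homogeneousComponent_totalDegree_ne_zero (hm.trans h') (by omega))
  have hjac : jac F G = 0 := by
    obtain ⟨r, -, hr⟩ := isUnit_iff_eq_C_of_isReduced.mp h.isUnit_jac
    have hcomp := congrArg (homogeneousComponent ((m - 1) + (m - 1))) hr
    rw [homogeneousComponent_of_mem (isHomogeneous_C _ r), if_neg (by omega)] at hcomp
    have hd : ∀ (i : Fin 2) (W : MvPolynomial (Fin 2) ℂ), W.totalDegree ≤ m →
        (pderiv i W).totalDegree ≤ m - 1 := fun i W hW =>
      (totalDegree_pderiv_le i W).trans (Nat.sub_le_sub_right hW 1)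
    rw [jac, map_sub, homogeneousComponent_mul_of_totalDegree_le (hd 0 U hU) (hd 1 V hV),
      homogeneousComponent_mul_of_totalDegree_le (hd 1 U hU) (hd 0 V hV)] at hcomp
    simp only [homogeneousComponent_pderiv, Nat.sub_add_cancel hlt.le] at hcomp
    exact hcomp
  obtain ⟨T, a, b, hFa, hGb⟩ := exists_common_factor_of_jac_eq_zero (by omega)
    (homogeneousComponent_isHomogeneous m U) (homogeneousComponent_isHomogeneous m V) hjac
  rw [← hF] at hFa
  rw [← hG] at hGb
  have hT : T ^ 2 ≠ 0 := by
    refine pow_ne_zero 2 ?_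
    rintro rfl
    simp [hFa, hGb] at hFG
  have hab : a ≠ 0 ∨ b ≠ 0 := by
    by_contra! hab
    simp [hFa, hGb, hab.1, hab.2] at hFG
  have eP : homogeneousComponent (m + m) (U * V) = C (a * b) * T ^ 2 := by
    rw [homogeneousComponent_mul_of_totalDegree_le hU hV, ← hF, ← hG, hFa, hGb, C_mul]
    ring
  have eU : homogeneousComponent (m + m) (U ^ 2) = C (a ^ 2) * T ^ 2 := by
    rw [sq U, homogeneousComponent_mul_of_totalDegree_le hU hU, ← hF, hFa, C_pow]
    ring
  have eV : homogeneousComponent (m + m) (V ^ 2) = C (b ^ 2) * T ^ 2 := by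
    rw [sq V, homogeneousComponent_mul_of_totalDegree_le hV hV, ← hG, hGb, C_pow]
    ring
  have eQ : homogeneousComponent (m + m) (U ^ 2 + V ^ 2) = C (a ^ 2 + b ^ 2) * T ^ 2 := by
    rw [map_add, eU, eV, C_add]
    ring
  have eR : homogeneousComponent (m + m) (U ^ 2 - V ^ 2) = C (a ^ 2 - b ^ 2) * T ^ 2 := by
    rw [map_sub, eU, eV, C_sub]
    ring
  obtain ⟨⟨sPQ, sPR, sQR⟩, -⟩ := h.separated
  have hPQ := sPQ.eq_zero_or_eq_zero _ eP eQ hT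
  have hPR := sPR.eq_zero_or_eq_zero _ eP eR hT
  have hQR := sQR.eq_zero_or_eq_zero _ eQ eR hT
  grind

theorem coeff_zero (h : IsLift φ U V) : coeff 0 U = 0 ∧ coeff 0 V = 0 := by
  obtain ⟨-, -, hQ, hR⟩ := h.separated
  have hQ := hQ.coeff_zero
  have hR := hR.coeff_zero
  simp only [← constantCoeff_eq, map_add, map_sub, map_pow] at hQ hR ⊢
  constructor
  · exact pow_eq_zero_iff two_ne_zero |>.mp (by linear_combination (hQ + hR) / 2)
  · exact pow_eq_zero_iff two_ne_zero |>.mp (by linear_combination (hQ - hR) / 2)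

end IsLift

theorem exists_linear_of_totalDegree_le_one {p : MvPolynomial (Fin 2) ℂ}
    (hp : p.totalDegree ≤ 1) (h0 : coeff 0 p = 0) :
    ∃ a b : ℂ, p = C a * X 0 + C b * X 1 := by
  have hder : ∀ i, ∃ a, pderiv i p = C a := fun i =>
    ⟨_, totalDegree_eq_zero_iff_eq_C.mp (by have := totalDegree_pderiv_le i p; omega)⟩
  obtain ⟨a, ha⟩ := hder 0
  obtain ⟨b, hb⟩ := hder 1
  refine ⟨a, b, ?_⟩
  have hC := eq_C_of_dvd_pderiv (p := p - (C a * X 0 + C b * X 1)) fun i => by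
    convert dvd_zero _ using 1
    fin_cases i
    · simp [ha, pderiv_X]
    · simp [hb, pderiv_X]
  have hcc : coeff 0 (p - (C a * X 0 + C b * X 1)) = 0 := by
    simp [h0]
  rw [hcc, C_0] at hC
  exact sub_eq_zero.mp hC

theorem HasNontrivialSigns.sq_eq {α β γ : ℂ}
    (h : HasNontrivialSigns (C α * X 0 ^ 2 + C β * (X 0 * X 1) + C γ * X 1 ^ 2)) :
    ∃ c d : ℂ, d * (d ^ 2 + c ^ 2) = 0 ∧
      (C α * X 0 ^ 2 + C β * (X 0 * X 1) + C γ * X 1 ^ 2) ^ 2 =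
        C c * invX (X 0) (X 1) + C d * invY (X 0) (X 1) := by
  have hI := C_I_sq (σ := Fin 2)
  have h2 := C_half_mul_two (σ := Fin 2)
  have eI : quatI (C α * X 0 ^ 2 + C β * (X 0 * X 1) + C γ * X 1 ^ 2) =
      -(C α * X 0 ^ 2) + C β * (X 0 * X 1) - C γ * X 1 ^ 2 := by
    simp [quatI, algebraMap_eq]
    linear_combination (C α * X 0 ^ 2 - C β * (X 0 * X 1) + C γ * X 1 ^ 2) * hI
  have eJ : quatJ (C α * X 0 ^ 2 + C β * (X 0 * X 1) + C γ * X 1 ^ 2) =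
      C α * X 1 ^ 2 - C β * (X 0 * X 1) + C γ * X 0 ^ 2 := by
    simp [quatJ, algebraMap_eq]
    ring
  unfold HasNontrivialSigns at h
  rw [eI, eJ] at h
  have ev : ∀ {p q : MvPolynomial (Fin 2) ℂ}, p = q → ∀ s t : ℂ, eval ![s, t] p = eval ![s, t] q :=
    fun h s t => by rw [h]
  rcases h with ⟨h, -⟩ | ⟨h, h'⟩ | ⟨h, h'⟩
  · have hα : α = 0 := by
      have := ev h 1 0
      simp at this
      linear_combination -this / 2
    have hγ : γ = 0 := by
      have := ev h 0 1
      simp at this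
      linear_combination -this / 2
    refine ⟨β ^ 2, 0, by ring, ?_⟩
    simp only [hα, hγ, invX, invY, C_0, C_pow]
    ring
  · have hβ : β = 0 := by
      have := ev h 1 1
      simp at this
      linear_combination this / 2
    have hγ : γ = α := by
      have := ev h' 1 0
      simpa using this
    refine ⟨2 * α ^ 2, 2 * Complex.I * α ^ 2, ?_, ?_⟩
    · linear_combination 8 * Complex.I * α ^ 6 * Complex.I_sq
    · simp only [hβ, hγ, invX, invY, C_0, C_mul, C_pow, C_neg_I_div_two, map_ofNat]
      linear_combination (X 0 ^ 4 + X 1 ^ 4) * C α ^ 2 * (2 * C (1 / 2) * hI - h2)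
  · have hβ : β = 0 := by
      have := ev h 1 1
      simp at this
      linear_combination this / 2
    have hγ : γ = -α := by
      have := ev h' 1 0
      simpa using this
    refine ⟨-2 * α ^ 2, 2 * Complex.I * α ^ 2, ?_, ?_⟩
    · linear_combination 8 * Complex.I * α ^ 6 * Complex.I_sq
    · simp only [hβ, hγ, invX, invY, C_0, C_mul, C_pow, C_neg, C_neg_I_div_two, map_ofNat]
      linear_combination (X 0 ^ 4 + X 1 ^ 4) * C α ^ 2 * (2 * C (1 / 2) * hI - h2)

/-- An automorphism maps `x` to a multiple of a linear factor of `x ^ 3 + x * y ^ 2`. -/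
theorem klein_aut_x (φ : Ad4 ≃ₐ[ℂ] Ad4) :
    ∃ c d : ℂ, d * (d ^ 2 + c ^ 2) = 0 ∧ φ 𝐱 = c • 𝐱 + d • 𝐲 := by
  obtain ⟨U, V, h⟩ := exists_isLift φ
  obtain ⟨a, b, hU⟩ := exists_linear_of_totalDegree_le_one h.totalDegree_le_one.1 h.coeff_zero.1
  obtain ⟨a', b', hV⟩ := exists_linear_of_totalDegree_le_one h.totalDegree_le_one.2 h.coeff_zero.2
  have hP := h.separated.2.1
  have eP : U * V = C (a * a') * X 0 ^ 2 + C (a * b' + b * a') * (X 0 * X 1) +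
      C (b * b') * X 1 ^ 2 := by
    rw [hU, hV]
    simp only [C_add, C_mul]
    ring
  rw [eP] at hP
  obtain ⟨c, d, hcd, hsq⟩ := hP.sq_eq
  refine ⟨c, d, hcd, kleinEmb_injective ?_⟩
  rw [h.map_x, invX, ← mul_pow, eP, hsq, map_add, map_smul, map_smul, kleinEmb_x, kleinEmb_y,
    smul_eq_C_mul, smul_eq_C_mul]

theorem klein_smul_add_smul_eq_zero {c d : ℂ} (h : c • 𝐱 + d • 𝐲 = (0 : Ad4)) :
    c = 0 ∧ d = 0 := by
  have hev : ∀ s t : ℂ, eval ![s, t] (kleinEmb (c • 𝐱 + d • 𝐲)) = 0 := fun s t => by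
    rw [h, map_zero, map_zero]
  simp only [map_add, map_smul, kleinEmb_x, kleinEmb_y, smul_eq_C_mul, invX, invY] at hev
  have h1 := hev 1 0
  have h2 := hev 1 1
  simp at h1 h2
  simp_all

theorem klein_diagonal_of_x {τ g : Ad4 ≃ₐ[ℂ] Ad4}
    (hτx : τ 𝐱 = (-(1 / 2 : ℂ)) • 𝐱 + (Complex.I / 2) • 𝐲)
    (hτy : τ 𝐲 = (3 * Complex.I / 2) • 𝐱 + (-(1 / 2 : ℂ)) • 𝐲)
    {c : ℂ} (hc : c ≠ 0) (hgx : g 𝐱 = c • 𝐱) :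
    ∃ l ε ε' : ℂ, l ≠ 0 ∧ (ε = 1 ∨ ε = -1) ∧ (ε' = 1 ∨ ε' = -1) ∧
      g 𝐱 = (l ^ 2) • 𝐱 ∧ g 𝐲 = (ε * l ^ 2) • 𝐲 ∧ g 𝐳 = (ε' * l ^ 3) • 𝐳 := by
  have hI := Complex.I_sq
  obtain ⟨p, q, hpq, h1⟩ := klein_aut_x (g * τ)
  obtain ⟨p', q', hpq', h2⟩ := klein_aut_x (g * τ * τ)
  simp only [AlgEquiv.mul_apply, hτx, hτy, map_add, map_smul, hgx] at h1 h2
  have hgy : g 𝐲 = (-2 * Complex.I * (p + c / 2)) • 𝐱 + (-2 * Complex.I * q) • 𝐲 := by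
    have : g 𝐲 = (-2 * Complex.I) • ((Complex.I / 2) • g 𝐲) := by
      rw [smul_smul, show -2 * Complex.I * (Complex.I / 2) = 1 by linear_combination -hI, one_smul]
    rw [this, ← sub_eq_of_eq_add' h1.symm]
    module
  rw [hgy] at h2
  have h3 : (p' + c + p) • 𝐱 + (q' + q) • 𝐲 = (0 : Ad4) := by
    have h4 : p' • 𝐱 + q' • 𝐲 = (-(c + p)) • 𝐱 + (-q) • 𝐲 := by
      rw [← h2]
      match_scalars
      · linear_combination (3 * c / 4 + p + c / 2) * hI
      · linear_combination q * hI
    rw [← sub_eq_zero] at h4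
    rw [← h4]
    module
  obtain ⟨hp', hq'⟩ := klein_smul_add_smul_eq_zero h3
  have hq : q ≠ 0 := by
    rintro rfl
    have h4 : g (c • 𝐲 - (-2 * Complex.I * (p + c / 2)) • 𝐱) = 0 := by
      rw [map_sub, map_smul, map_smul, hgy, hgx]
      module
    have h5 : (-(-2 * Complex.I * (p + c / 2))) • 𝐱 + c • 𝐲 = (0 : Ad4) := by
      rw [← (map_eq_zero_iff g g.injective).mp h4]
      module
    exact hc (klein_smul_add_smul_eq_zero h5).2
  have e1 : q ^ 2 + p ^ 2 = 0 := (mul_eq_zero.mp hpq).resolve_left hq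
  have e2 : q ^ 2 + (c + p) ^ 2 = 0 := by
    obtain rfl : q' = -q := by linear_combination hq'
    obtain rfl : p' = -(c + p) := by linear_combination hp'
    have := (mul_eq_zero.mp hpq').resolve_left (neg_ne_zero.mpr hq)
    linear_combination this
  have e3 : p + c / 2 = 0 := mul_left_cancel₀ hc (by linear_combination (e2 - e1) / 2)
  rw [e3, mul_zero, zero_smul, zero_add] at hgy
  obtain ⟨l, rfl⟩ := IsAlgClosed.exists_pow_nat_eq c (n := 2) (by norm_num)
  have hl : l ≠ 0 := by
    rintro rfl
    simp at hc
  have hq2 : (-2 * Complex.I * q) ^ 2 = (l ^ 2) ^ 2 := by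
    linear_combination 4 * q ^ 2 * hI - 4 * e1 + 4 * (p - l ^ 2 / 2) * e3
  have hε : ∃ ε : ℂ, (ε = 1 ∨ ε = -1) ∧ -2 * Complex.I * q = ε * l ^ 2 := by
    rcases sq_eq_sq_iff_eq_or_eq_neg.mp hq2 with h | h
    · exact ⟨1, Or.inl rfl, by rw [h, one_mul]⟩
    · exact ⟨-1, Or.inr rfl, by rw [h, neg_one_mul]⟩
  obtain ⟨ε, hε, hεq⟩ := hε
  rw [hεq] at hgy
  have hz : kleinEmb (g 𝐳) ^ 2 = kleinEmb (l ^ 3 • 𝐳) ^ 2 := by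
    have r1 := kleinEmb_aut_relation g
    have r2 := congrArg kleinEmb klein_relation
    have hε2 : ε ^ 2 = 1 := by rcases hε with rfl | rfl <;> norm_num
    have hε2' : (C ε : MvPolynomial (Fin 2) ℂ) ^ 2 = 1 := by rw [← C_pow, hε2, C_1]
    rw [hgx, hgy] at r1
    simp only [map_add, map_smul, map_mul, map_pow, map_zero, smul_eq_C_mul] at r1 r2 ⊢
    linear_combination r1 - C l ^ 6 * r2 - C l ^ 6 * kleinEmb 𝐱 * kleinEmb 𝐲 ^ 2 * hε2'
  rcases sq_eq_sq_iff_eq_or_eq_neg.mp hz with h | h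
  · exact ⟨l, ε, 1, hl, hε, Or.inl rfl, hgx, hgy, by rw [one_mul]; exact kleinEmb_injective h⟩
  · refine ⟨l, ε, -1, hl, hε, Or.inr rfl, hgx, hgy, kleinEmb_injective ?_⟩
    rw [h, ← map_neg, neg_one_mul, neg_smul]

/-- Every automorphism of A is a diagonal automorphism composed with a power of the
triality automorphism τ. -/
theorem d4_aut_structure (τ : Ad4 ≃ₐ[ℂ] Ad4)
    (hτx : τ (Ideal.Quotient.mk Id4 (X 0)) =
      (-(1 / 2 : ℂ)) • Ideal.Quotient.mk Id4 (X 0) +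
        (Complex.I / 2) • Ideal.Quotient.mk Id4 (X 1))
    (hτy : τ (Ideal.Quotient.mk Id4 (X 1)) =
      (3 * Complex.I / 2) • Ideal.Quotient.mk Id4 (X 0) +
        (-(1 / 2 : ℂ)) • Ideal.Quotient.mk Id4 (X 1))
    (hτz : τ (Ideal.Quotient.mk Id4 (X 2)) = Ideal.Quotient.mk Id4 (X 2))
    (φ : Ad4 ≃ₐ[ℂ] Ad4) :
    ∃ k : ℕ, k ≤ 2 ∧
      ∃ (l ε ε' : ℂ), l ≠ 0 ∧ (ε = 1 ∨ ε = -1) ∧ (ε' = 1 ∨ ε' = -1) ∧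
        ∃ g : Ad4 ≃ₐ[ℂ] Ad4,
          g (Ideal.Quotient.mk Id4 (X 0)) =
            (l ^ 2) • Ideal.Quotient.mk Id4 (X 0) ∧
          g (Ideal.Quotient.mk Id4 (X 1)) =
            (ε * l ^ 2) • Ideal.Quotient.mk Id4 (X 1) ∧
          g (Ideal.Quotient.mk Id4 (X 2)) =
            (ε' * l ^ 3) • Ideal.Quotient.mk Id4 (X 2) ∧
          φ = g * τ ^ k := by
  have hI := Complex.I_sq
  have hτ2 : τ (τ 𝐱) = (-(1 / 2 : ℂ)) • 𝐱 + (-(Complex.I / 2)) • 𝐲 := by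
    rw [hτx, map_add, map_smul, map_smul, hτx, hτy]
    match_scalars
    · linear_combination 3 / 4 * hI
    · ring
  have hτ3 : τ ^ 3 = 1 := by
    refine AlgEquiv.ext fun a => DFunLike.congr_fun (f := ((τ ^ 3 : Ad4 ≃ₐ[ℂ] Ad4) : Ad4 →ₐ[ℂ] Ad4))
      (g := AlgHom.id ℂ Ad4) (klein_algHom_ext ?_ ?_ ?_) a
    · change τ (τ (τ 𝐱)) = 𝐱
      rw [hτ2, map_add, map_smul, map_smul, hτx, hτy]
      match_scalars
      · linear_combination -(3 / 4) * hI
      · ring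
    · change τ (τ (τ 𝐲)) = 𝐲
      simp only [hτx, hτy, map_add, map_smul]
      match_scalars
      · linear_combination 9 / 8 * Complex.I * hI
      · linear_combination -(9 / 8) * hI
    · change τ (τ (τ 𝐳)) = 𝐳
      rw [hτz, hτz, hτz]
  obtain ⟨c, d, hcd, hx⟩ := klein_aut_x φ.symm
  obtain ⟨j, k, hk, hjk, e, he⟩ : ∃ j k : ℕ, k ≤ 2 ∧ τ ^ j * τ ^ k = 1 ∧
      ∃ e : ℂ, φ.symm 𝐱 = e • (τ ^ j) 𝐱 := by
    have hfac : d = 0 ∨ d = Complex.I * c ∨ d = -(Complex.I * c) := by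
      rcases mul_eq_zero.mp hcd with h | h
      · exact Or.inl h
      · exact Or.inr (sq_eq_sq_iff_eq_or_eq_neg.mp (by linear_combination h - c ^ 2 * hI))
    rcases hfac with rfl | rfl | rfl
    · exact ⟨0, 0, by norm_num, by simp, c, by simp [hx]⟩
    · refine ⟨2, 1, by norm_num, by rw [← pow_add, hτ3], -2 * c, ?_⟩
      rw [hx, sq, AlgEquiv.mul_apply, hτ2]
      module
    · refine ⟨1, 2, by norm_num, by rw [← pow_add, hτ3], -2 * c, ?_⟩
      rw [hx, pow_one, hτx]
      module
  have hφ : e • (φ * τ ^ j) 𝐱 = 𝐱 := by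
    rw [AlgEquiv.mul_apply, ← map_smul, ← he, AlgEquiv.apply_symm_apply]
  have he0 : e ≠ 0 := by
    rintro rfl
    rw [zero_smul] at hφ
    have h1 : (1 : ℂ) • 𝐱 + (0 : ℂ) • 𝐲 = (0 : Ad4) := by rw [← hφ]; module
    exact one_ne_zero (klein_smul_add_smul_eq_zero h1).1
  have hgx : (φ * τ ^ j) 𝐱 = e⁻¹ • 𝐱 := by
    rw [← hφ, inv_smul_smul₀ he0, hφ]
  obtain ⟨l, ε, ε', hl, hε, hε', gx, gy, gz⟩ :=
    klein_diagonal_of_x hτx hτy (inv_ne_zero he0) hgx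
  exact ⟨k, hk, l, ε, ε', hl, hε, hε', φ * τ ^ j, gx, gy, gz, by rw [mul_assoc, hjk, mul_one]⟩

end
end
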